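/- arXiv:math/0110146 — 5 statements merged into one kernel-verified Lean document; each statement's English description precedes it below -/
import Mathlib

section
/- Let (P_i)_{i∈ω} be special partitions of subsets of ω, each with infinitely many blocks, such that P_0 ⊒* P_1 ⊒* P_2 ⊒* ⋯ (each P_{i+1} almost-coarsens P_i). Then there exists a special partition P of a subset of ω with infinitely many blocks such that P ⊒* P_i for every i∈ω. -/
/-- A special partition of a subset of `ω` with infinitely many blocks:
the blocks are nonempty finite sets of naturals, enumerated in increasing order
(every element of block `k` is less than every element of block `k+1`). -/
structure SpecialPartition where
  block : ℕ → Finset ℕ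
  nonempty : ∀ k, (block k).Nonempty
  ordered : ∀ k, ∀ a ∈ block k, ∀ b ∈ block (k + 1), a < b

/-- The finite set `s` is a union of blocks of `Q`. -/
def IsUnionOfBlocks (s : Finset ℕ) (Q : SpecialPartition) : Prop :=
  ∃ S : Finset ℕ, s = S.biUnion Q.block

/-- `AlmostCoarser P Q` (`P ⊑* Q`): all but finitely many blocks of `P` are
unions of blocks of `Q`, i.e. `P` is coarser than `Q` modulo finitely many blocks. -/
def AlmostCoarser (P Q : SpecialPartition) : Prop :=
  ∃ n : ℕ, ∀ k, n ≤ k → IsUnionOfBlocks (P.block k) Q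

theorem SpecialPartition.le_of_mem_block (P : SpecialPartition) (k : ℕ) :
    ∀ a ∈ P.block k, k ≤ a := by
  induction k with
  | zero => simp
  | succ k ih =>
    intro a ha
    obtain ⟨b, hb⟩ := P.nonempty k
    exact (ih b hb).trans_lt (P.ordered k b hb a ha)

theorem IsUnionOfBlocks.of_blocks {Q R : SpecialPartition} {S : Finset ℕ}
    (h : ∀ j ∈ S, IsUnionOfBlocks (Q.block j) R) :
    IsUnionOfBlocks (S.biUnion Q.block) R := by
  choose! T hT using h
  refine ⟨S.biUnion T, ?_⟩
  rw [Finset.biUnion_biUnion]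
  exact Finset.biUnion_congr rfl hT

theorem AlmostCoarser.refl (P : SpecialPartition) : AlmostCoarser P P :=
  ⟨0, fun k _ => ⟨{k}, by simp⟩⟩

theorem AlmostCoarser.trans {P Q R : SpecialPartition}
    (hPQ : AlmostCoarser P Q) (hQR : AlmostCoarser Q R) : AlmostCoarser P R := by
  obtain ⟨m, hm⟩ := hPQ
  obtain ⟨n, hn⟩ := hQR
  choose e he using Q.nonempty
  refine ⟨max m ((Finset.range n).sup e + 1), fun k hk => ?_⟩
  obtain ⟨S, hS⟩ := hm k (le_of_max_le_left hk)
  rw [hS]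
  refine IsUnionOfBlocks.of_blocks fun j hj => hn j ?_
  by_contra! hjn
  have hle : e j ≤ (Finset.range n).sup e := Finset.le_sup (Finset.mem_range.2 hjn)
  have hmem : e j ∈ P.block k := hS ▸ Finset.mem_biUnion.2 ⟨j, hj, he j⟩
  have := P.le_of_mem_block k _ hmem
  have := le_of_max_le_right hk
  omega

theorem AlmostCoarser.of_le {P : ℕ → SpecialPartition}
    (hchain : ∀ i, AlmostCoarser (P (i + 1)) (P i)) {i n : ℕ} (h : i ≤ n) :
    AlmostCoarser (P n) (P i) := by
  induction n, h using Nat.le_induction with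
  | base => exact .refl _
  | succ n _ ih => exact (hchain n).trans ih

/-- Along a chain, arbitrarily far out there are nonempty finite sets that are unions of blocks
of each of the first `n + 1` partitions. -/
theorem exists_common_union {P : ℕ → SpecialPartition}
    (hchain : ∀ i, AlmostCoarser (P (i + 1)) (P i)) (n m : ℕ) :
    ∃ s : Finset ℕ, s.Nonempty ∧ (∀ a ∈ s, m ≤ a) ∧ ∀ i ≤ n, IsUnionOfBlocks s (P i) := by
  have h : ∀ i ≤ n, AlmostCoarser (P n) (P i) := fun i hi => .of_le hchain hi
  choose! T hT using h
  refine ⟨(P n).block (max m ((Finset.range (n + 1)).sup T)), (P n).nonempty _,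
    fun a ha => (le_max_left _ _).trans ((P n).le_of_mem_block _ a ha), fun i hi => ?_⟩
  exact hT i hi _ ((Finset.le_sup (Finset.mem_range.2 (Nat.lt_succ_of_le hi))).trans
    (le_max_right _ _))

/-- Fact 1.1: given a chain of special partitions each of which almost-coarsens the
previous one, there is a single special partition almost-coarsening all of them. -/
theorem stmt_0 (P : ℕ → SpecialPartition)
    (hchain : ∀ i : ℕ, AlmostCoarser (P (i + 1)) (P i)) :
    ∃ R : SpecialPartition, ∀ i : ℕ, AlmostCoarser R (P i) := by
  choose f hne hge hunion using exists_common_union hchain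
  let s : ℕ → Finset ℕ := fun n => Nat.rec (f 0 0) (fun n t => f (n + 1) (t.sup id + 1)) n
  refine ⟨⟨s, fun k => ?_, fun k a ha b hb => ?_⟩, fun i => ⟨i, fun k hk => ?_⟩⟩
  · cases k <;> exact hne _ _
  · exact (Finset.le_sup (f := id) ha).trans_lt (hge _ _ b hb)
  · cases k <;> exact hunion _ _ i hk
end

section
/- Let X be a Banach space, K < ∞, and let (x_i^n)_{n,i∈ω} be a K-basic array in X. Let (ε_n)_{n∈ω} be a sequence of positive reals decreasing to 0. Then there exists a strictly increasing sequence (k_n)_{n∈ω} of natural numbers such that for every n ≥ 1, every (b_j)_{j<n} ∈ [−1,1]^n, and all integers n ≤ i_0 < ⋯ < i_{n−1} and n ≤ ℓ_0 < ⋯ < ℓ_{n−1}, one has | ‖Σ_{j<n} b_j x^j_{k_{i_j}}‖ − ‖Σ_{j<n} b_j x^j_{k_{ℓ_j}}‖ | < ε_n. -/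
open Filter Finset Topology

variable {X : Type*} [NormedAddCommGroup X] [NormedSpace ℝ X]
variable {E : Type*} [NormedAddCommGroup E] [NormedSpace ℝ E]

/-- `(x i)` is a `C`-basic sequence. -/
def IsCBasic (C : ℝ) (x : ℕ → X) : Prop :=
  (∀ i, x i ≠ 0) ∧
    ∀ n m : ℕ, n < m → ∀ a : ℕ → ℝ,
      ‖∑ i ∈ Finset.range n, a i • x i‖ ≤ C * ‖∑ i ∈ Finset.range m, a i • x i‖

/-- The finite sequence `y 0, …, y (m-1)` is `C`-basic. -/
def IsCBasicUpTo (C : ℝ) (m : ℕ) (y : ℕ → X) : Prop :=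
  (∀ j, j < m → y j ≠ 0) ∧
    ∀ n k : ℕ, n < k → k ≤ m → ∀ a : ℕ → ℝ,
      ‖∑ i ∈ Finset.range n, a i • y i‖ ≤ C * ‖∑ i ∈ Finset.range k, a i • y i‖

/-- `(x i)` is normalized. -/
def Normalized (x : ℕ → X) : Prop := ∀ i, ‖x i‖ = 1

/-- `x` is a `K`-basic array: each row `x n` is a normalized `K`-basic sequence and every
"diagonal" sequence `(x j (i j))_{j<m}` with `m ≤ i 0 < i 1 < ⋯` is `K`-basic. -/
def IsBasicArrayWith (K : ℝ) (x : ℕ → ℕ → X) : Prop :=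
  (∀ n, Normalized (x n) ∧ IsCBasic K (x n)) ∧
    ∀ (m : ℕ) (i : ℕ → ℕ), StrictMono i → m ≤ i 0 →
      IsCBasicUpTo K m fun j => x j (i j)

/-- `x` is a basic array if it is a `K`-basic array for some `K`. -/
def IsBasicArray (x : ℕ → ℕ → X) : Prop := ∃ K : ℝ, IsBasicArrayWith K x

/-- Along an ultrafilter, a map to a finite type is eventually constant. -/
theorem Ultrafilter.exists_eventually_eq_of_finite {α C : Type*} [Finite C] (U : Ultrafilter α)
    (f : α → C) : ∃ a, ∀ᶠ i in (U : Filter α), f i = a := by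
  obtain ⟨a, ha⟩ := Ultrafilter.eq_pure_of_finite (U.map f)
  refine ⟨a, ?_⟩
  have h : ({a} : Set C) ∈ U.map f := by rw [ha]; exact Set.mem_singleton a
  exact h

/-- A property that holds eventually for each list holds eventually for all lists of bounded
length with bounded entries at once. -/
theorem Filter.eventually_forall_list {α : Type*} (F : Filter α) (N L : ℕ)
    (P : List ℕ → α → Prop) (hP : ∀ s, ∀ᶠ i in F, P s i) :
    ∀ᶠ i in F, ∀ s : List ℕ, s.length ≤ L → (∀ a ∈ s, a ≤ N) → P s i := by
  induction L generalizing P with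
  | zero =>
    filter_upwards [hP []] with i hi s hs _
    rw [List.length_eq_zero_iff.mp (Nat.le_zero.mp hs)]
    exact hi
  | succ L ih =>
    have h := ih (fun t i => ∀ a ∈ Set.Iic N, P (a :: t) i) fun t =>
      (eventually_all_finite (Set.finite_Iic N)).2 fun a _ => hP (a :: t)
    filter_upwards [hP [], h] with i hi h s hs hN
    cases s with
    | nil => exact hi
    | cons a t =>
      exact h t (by simpa using hs) (fun b hb => hN b (List.mem_cons_of_mem a hb)) a
        (hN a List.mem_cons_self)

/-- Iterated limits of a finite colouring of lists along an ultrafilter. -/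
theorem Ultrafilter.exists_iterated_limit {C : Type*} [Finite C] (U : Ultrafilter ℕ)
    (c : List ℕ → C) : ∃ e : ℕ → List ℕ → C, e 0 = c ∧
      ∀ d s, ∀ᶠ i in (U : Filter ℕ), e d (i :: s) = e (d + 1) s := by
  choose lim h_lim using fun f : ℕ → C => U.exists_eventually_eq_of_finite f
  exact ⟨fun d => Nat.rec c (fun _ g s => lim fun i => g (i :: s)) d, rfl,
    fun d s => h_lim _⟩

/-- A diagonal form of Ramsey's theorem: given a finite colouring `c n` for each `n`, there is a
subsequence along which `c n` is constant on the `n`-element sets of indices that are `≥ n`.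
Finite sets are represented by decreasing lists. -/
theorem exists_strictMono_homogeneous {C : ℕ → Type*} [∀ n, Finite (C n)]
    (c : ∀ n, List ℕ → C n) : ∃ k : ℕ → ℕ, StrictMono k ∧ ∀ n, ∃ a : C n, ∀ s : List ℕ,
      s.length = n → s.Pairwise (· > ·) → (∀ i ∈ s, n ≤ i) → c n (s.map k) = a := by
  choose e he0 he using fun n => (hyperfilter ℕ).exists_iterated_limit (c n)
  have hstep : ∀ m N : ℕ, ∃ i, N < i ∧ ∀ n ∈ Set.Iic m, ∀ d ∈ Set.Iic m, ∀ s : List ℕ,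
      s.length ≤ m → (∀ a ∈ s, a ≤ N) → e n d (i :: s) = e n (d + 1) s := by
    intro m N
    have h1 : ∀ᶠ i in (hyperfilter ℕ : Filter ℕ), N < i :=
      Nat.hyperfilter_le_atTop (eventually_gt_atTop N)
    have h2 : ∀ᶠ i in (hyperfilter ℕ : Filter ℕ), ∀ n ∈ Set.Iic m, ∀ d ∈ Set.Iic m,
        ∀ s : List ℕ, s.length ≤ m → (∀ a ∈ s, a ≤ N) → e n d (i :: s) = e n (d + 1) s :=
      (eventually_all_finite (Set.finite_Iic m)).2 fun n _ =>
        (eventually_all_finite (Set.finite_Iic m)).2 fun d _ =>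
          Filter.eventually_forall_list _ N m _ fun s => he n d s
    exact (h1.and h2).exists
  choose next hlt hnext using hstep
  let k : ℕ → ℕ := fun m => Nat.rec 0 (fun m N => next (m + 1) N) m
  have hk : StrictMono k := strictMono_nat_of_lt_succ fun m => hlt (m + 1) (k m)
  refine ⟨k, hk, fun n => ⟨e n n [], ?_⟩⟩
  have key : ∀ s : List ℕ, ∀ d, s.length + d = n → s.Pairwise (· > ·) → (∀ i ∈ s, n ≤ i) →
      e n d (s.map k) = e n n [] := by
    intro s
    induction s with
    | nil => intro d hd _ _; simp at hd; subst hd; rfl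
    | cons i s ih =>
      intro d hd hs hn
      rw [List.length_cons] at hd
      rw [List.pairwise_cons] at hs
      have hi : n ≤ i := hn i List.mem_cons_self
      obtain ⟨m, rfl⟩ : ∃ m, i = m + 1 := ⟨i - 1, by omega⟩
      rw [← ih (d + 1) (by omega) hs.2 fun j hj => hn j (List.mem_cons_of_mem _ hj),
        List.map_cons]
      refine hnext (m + 1) (k m) n hi d (by simp only [Set.mem_Iic]; omega) _
        (by rw [List.length_map]; omega) ?_
      intro a ha
      obtain ⟨j, hj, rfl⟩ := List.mem_map.mp ha
      exact hk.monotone (Nat.lt_succ_iff.mp (hs.1 j hj))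
  intro s hs hp hn
  rw [← key s 0 (by omega) hp hn, he0]

/-- Perturbing the coefficients of a linear combination of unit vectors. -/
theorem abs_norm_sum_smul_sub_le {X : Type*} [NormedAddCommGroup X] [NormedSpace ℝ X] (n : ℕ)
    (y : ℕ → X) (hy : ∀ j, ‖y j‖ = 1) (b b' : ℕ → ℝ) (δ : ℝ) (h : ∀ j < n, |b j - b' j| ≤ δ) :
    |‖∑ j ∈ Finset.range n, b j • y j‖ - ‖∑ j ∈ Finset.range n, b' j • y j‖| ≤ n * δ := by
  refine (abs_norm_sub_norm_le _ _).trans ?_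
  rw [← Finset.sum_sub_distrib]
  refine (norm_sum_le_of_le (Finset.range n) (f := fun j => b j • y j - b' j • y j)
    (n := fun _ => δ) fun j hj => ?_).trans (by simp)
  rw [← sub_smul, norm_smul, hy, mul_one]
  exact h j (Finset.mem_range.mp hj)

/-- A point of `[-1, 1]` lies within `1 / N` of the grid `{(z - N) / N | z ≤ 2 N}`. -/
theorem exists_grid_approx (N : ℕ) (hN : 0 < N) (t : ℝ) (ht : |t| ≤ 1) :
    ∃ z : Fin (2 * N + 1), |t - ((z : ℕ) - N : ℝ) / N| ≤ 1 / N := by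
  have hN' : (0 : ℝ) < N := Nat.cast_pos.mpr hN
  obtain ⟨h1, h2⟩ := abs_le.mp ht
  have h0 : 0 ≤ (t + 1) * N := mul_nonneg (by linarith) hN'.le
  have hf1 := Nat.floor_le h0
  have hf2 := Nat.lt_floor_add_one ((t + 1) * N)
  have hz : ⌊(t + 1) * N⌋₊ < 2 * N + 1 := by
    rw [Nat.lt_succ_iff]
    refine Nat.floor_le_of_le ?_
    push_cast
    nlinarith
  refine ⟨⟨_, hz⟩, ?_⟩
  have : t - ((⌊(t + 1) * N⌋₊ : ℝ) - N) / N = ((t + 1) * N - ⌊(t + 1) * N⌋₊) / N := by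
    field_simp
    ring
  rw [this, abs_div, abs_of_pos hN', abs_of_nonneg (by linarith)]
  gcongr
  linarith

/-- The norms of linear combinations, with coefficients in `[-1, 1]`, of `n` unit vectors are
determined up to `ε` by finitely many colours. -/
theorem exists_finite_coloring_norm (X : Type*) [NormedAddCommGroup X] [NormedSpace ℝ X] (n : ℕ)
    (ε : ℝ) (hε : 0 < ε) : ∃ (C : Type) (_ : Finite C) (c : (ℕ → X) → C), ∀ y y' : ℕ → X,
      (∀ j, ‖y j‖ = 1) → (∀ j, ‖y' j‖ = 1) → c y = c y' →
      ∀ b : ℕ → ℝ, (∀ j, j < n → |b j| ≤ 1) →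
        |‖∑ j ∈ Finset.range n, b j • y j‖ - ‖∑ j ∈ Finset.range n, b j • y' j‖| < ε := by
  obtain ⟨N, hN⟩ := exists_nat_gt ((2 * n + 1) / ε)
  have hN' : (0 : ℝ) < N := lt_of_le_of_lt (by positivity) hN
  let g : (Fin n → Fin (2 * N + 1)) → ℕ → ℝ := fun z j =>
    if h : j < n then ((z ⟨j, h⟩ : ℕ) - N : ℝ) / N else 0
  let F : (ℕ → X) → (Fin n → Fin (2 * N + 1)) → ℕ := fun y z =>
    ⌊N * ‖∑ j ∈ Finset.range n, g z j • y j‖⌋₊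
  have hg : ∀ z, ∀ j < n, |g z j - 0| ≤ 1 := by
    intro z j hj
    have h1 : ((z ⟨j, hj⟩ : ℕ) : ℝ) ≤ 2 * N := by exact_mod_cast Nat.lt_succ_iff.mp (z ⟨j, hj⟩).2
    have h0 : (0 : ℝ) ≤ (z ⟨j, hj⟩ : ℕ) := Nat.cast_nonneg _
    simp only [g, dif_pos hj, sub_zero]
    rw [abs_div, abs_of_pos hN', div_le_one hN', abs_le]
    constructor <;> linarith
  let c : (ℕ → X) → (Fin n → Fin (2 * N + 1)) → Fin (N * n + 1) := fun y z =>
    Fin.ofNat (N * n + 1) (F y z)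
  have hcF : ∀ y, (∀ j, ‖y j‖ = 1) → ∀ z, (c y z : ℕ) = F y z := by
    intro y hy z
    refine Nat.mod_eq_of_lt (Nat.lt_succ_iff.mpr (Nat.floor_le_of_le ?_))
    have := abs_norm_sum_smul_sub_le n y hy (g z) (fun _ => 0) 1 (hg z)
    simp only [zero_smul, Finset.sum_const_zero, norm_zero, sub_zero, abs_norm, mul_one] at this
    push_cast
    gcongr
  refine ⟨_, inferInstance, c, fun y y' hy hy' hc b hb => ?_⟩
  choose z hz using fun j : Fin n =>
    exists_grid_approx N (Nat.cast_pos.mp hN') (b j) (hb j j.2)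
  have hbz : ∀ j < n, |b j - g z j| ≤ 1 / N := by
    intro j hj
    simpa only [g, dif_pos hj] using hz ⟨j, hj⟩
  have hF : F y z = F y' z := by rw [← hcF y hy, ← hcF y' hy', hc]
  have h1 := abs_norm_sum_smul_sub_le n y hy b (g z) _ hbz
  have h2 := abs_norm_sum_smul_sub_le n y' hy' b (g z) _ hbz
  set u := ‖∑ j ∈ Finset.range n, g z j • y j‖
  set u' := ‖∑ j ∈ Finset.range n, g z j • y' j‖
  have h3 : |u - u'| ≤ 1 / N := by
    have e1 := Nat.floor_le (show 0 ≤ N * u by positivity)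
    have e2 := Nat.lt_floor_add_one (N * u)
    have e3 := Nat.floor_le (show 0 ≤ N * u' by positivity)
    have e4 := Nat.lt_floor_add_one (N * u')
    have e : (⌊N * u⌋₊ : ℝ) = ⌊N * u'⌋₊ := congrArg Nat.cast hF
    rw [abs_le, neg_le, le_div_iff₀ hN', le_div_iff₀ hN']
    constructor <;> linarith
  have h4 : 2 * (n * (1 / N : ℝ)) + 1 / N < ε := by
    rw [div_lt_iff₀ hε] at hN
    have : 2 * (n * (1 / N : ℝ)) + 1 / N = (2 * n + 1) / N := by ring
    rw [this, div_lt_iff₀ hN']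
    linarith
  rw [abs_le] at h1 h2 h3
  rw [abs_lt]
  constructor <;> linarith

/-- Proposition 3.1: every `K`-basic array has a subarray which stabilizes,
up to `ε n`, the norms of linear combinations along diagonals. -/
theorem stmt_1 {X : Type*} [NormedAddCommGroup X] [NormedSpace ℝ X] [CompleteSpace X]
    (K : ℝ) (x : ℕ → ℕ → X) (hx : IsBasicArrayWith K x)
    (ε : ℕ → ℝ) (hεpos : ∀ n, 0 < ε n) (hεanti : Antitone ε)
    (hεlim : Filter.Tendsto ε Filter.atTop (nhds 0)) :
    ∃ k : ℕ → ℕ, StrictMono k ∧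
      ∀ n : ℕ, 1 ≤ n → ∀ b : ℕ → ℝ, (∀ j, j < n → |b j| ≤ 1) →
        ∀ i l : ℕ → ℕ, StrictMono i → n ≤ i 0 → StrictMono l → n ≤ l 0 →
          |‖∑ j ∈ Finset.range n, b j • x j (k (i j))‖ -
            ‖∑ j ∈ Finset.range n, b j • x j (k (l j))‖| < ε n := by
  choose C hC c hc using fun n => exists_finite_coloring_norm X n (ε n) (hεpos n)
  have hunit : ∀ j i, ‖x j i‖ = 1 := fun j => (hx.1 j).1
  obtain ⟨k, hk, hhom⟩ := exists_strictMono_homogeneous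
    fun n s => c n fun j => x j (s.reverse.getD j 0)
  refine ⟨k, hk, fun n _ b hb i l hi hi0 hl hl0 => ?_⟩
  obtain ⟨a, ha⟩ := hhom n
  have hcolor : ∀ i : ℕ → ℕ, StrictMono i → n ≤ i 0 →
      c n (fun j => x j ((((List.range n).map i).map k).getD j 0)) = a := by
    intro i hi hi0
    have h := ha ((List.range n).map i).reverse (by simp) ?_ ?_
    · simpa only [List.map_reverse, List.reverse_reverse] using h
    · rw [List.pairwise_reverse, List.pairwise_map]
      exact List.pairwise_lt_range.imp fun h => hi h
    · intro m hm
      simp only [List.mem_reverse, List.mem_map] at hm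
      obtain ⟨j, -, rfl⟩ := hm
      exact hi0.trans (hi.monotone (Nat.zero_le j))
  have hsum : ∀ i : ℕ → ℕ, ∑ j ∈ Finset.range n, b j • x j (k (i j)) =
      ∑ j ∈ Finset.range n, b j • x j ((((List.range n).map i).map k).getD j 0) := by
    intro i
    refine Finset.sum_congr rfl fun j hj => ?_
    rw [Finset.mem_range] at hj
    simp [List.getD, hj]
  rw [hsum i, hsum l]
  exact hc n _ _ (fun j => hunit j _) (fun j => hunit j _)
    ((hcolor i hi hi0).trans (hcolor l hl hl0).symm) b hb
end

section
/- Let (x_i)_{i∈ω} be a basic sequence in a Banach space X and for each n∈ω let (x_i^n)_{i∈ω} be a normalized block basis of (x_i)_{i∈ω}. Then the array (x_i^n)_{n,i∈ω} admits a subarray (y_i^n)_{n,i∈ω} (that is, y_i^n = x_{k_i}^n for some strictly increasing sequence (k_i)) which is a block basic array of (x_i)_{i∈ω}: it is a basic array, each row is a block basis of (x_i)_{i∈ω}, and for every m and all integers m ≤ i_0 < ⋯ < i_{m−1} the sequence (y_{i_j}^j)_{j<m} is a block basis of (x_i)_{i∈ω}. -/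
open Filter Finset Topology

variable {X : Type*} [NormedAddCommGroup X] [NormedSpace ℝ X]
variable {E : Type*} [NormedAddCommGroup E] [NormedSpace ℝ E]

/-- `y` is a (normalized or not) block basis of `x`. -/
def IsBlockBasisOf (x y : ℕ → X) : Prop :=
  ∃ (p : ℕ → ℕ) (b : ℕ → ℝ), StrictMono p ∧ (∀ j, y j ≠ 0) ∧
    ∀ j, y j = ∑ l ∈ Finset.Ico (p j) (p (j + 1)), b l • x l

/-- The finite sequence `y 0, …, y (m-1)` is a block basis of `x`. -/
def IsBlockBasisUpTo (m : ℕ) (x y : ℕ → X) : Prop :=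
  ∃ (p : ℕ → ℕ) (b : ℕ → ℝ), StrictMono p ∧ (∀ j, j < m → y j ≠ 0) ∧
    ∀ j, j < m → y j = ∑ l ∈ Finset.Ico (p j) (p (j + 1)), b l • x l

/-- `x` is a block basic array with respect to `x0`: it is a basic array, each row is a
block basis of `x0`, and every diagonal `(x j (i j))_{j<m}` with `m ≤ i 0 < i 1 < ⋯`
is a block basis of `x0`. -/
def IsBlockBasicArray (x0 : ℕ → X) (x : ℕ → ℕ → X) : Prop :=
  IsBasicArray x ∧ (∀ n, IsBlockBasisOf x0 (x n)) ∧
    ∀ (m : ℕ) (i : ℕ → ℕ), StrictMono i → m ≤ i 0 →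
      IsBlockBasisUpTo m x0 fun j => x j (i j)

/-- Coefficients prescribed on the consecutive intervals `[q j, r j)` glue to one sequence of
coefficients vanishing off these intervals. -/
theorem exists_glued_coeff {R : Type*} [Zero R] {q r : ℕ → ℕ} (hq : StrictMono q)
    (hrq : ∀ j, r j ≤ q (j + 1)) (c : ℕ → ℕ → R) :
    ∃ d : ℕ → R, (∀ j l, q j ≤ l → l < r j → d l = c j l) ∧
      ∀ l, (∀ j, q j ≤ l → r j ≤ l) → d l = 0 := by
  classical
  refine ⟨fun l => if h : ∃ j, q j ≤ l ∧ l < r j then c h.choose l else 0, ?_, ?_⟩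
  · intro j l h1 h2
    have h : ∃ j, q j ≤ l ∧ l < r j := ⟨j, h1, h2⟩
    have hle : ∀ s t, q s ≤ l → l < r t → s ≤ t := by
      intro s t hs ht
      by_contra! hlt
      have := hq.monotone (Nat.succ_le_of_lt hlt)
      have := hrq t
      simp only [Nat.succ_eq_add_one] at *
      omega
    have hj : h.choose = j :=
      le_antisymm (hle _ _ h.choose_spec.1 h2) (hle _ _ h1 h.choose_spec.2)
    simp only [dif_pos h, hj]
  · intro l hl
    refine dif_neg ?_
    rintro ⟨j, h1, h2⟩
    exact absurd (hl j h1) (not_le.2 h2)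

/-- Nonzero vectors supported on consecutive, possibly non-adjacent, intervals form a block
basis. -/
theorem isBlockBasisOf_of_intervals {x y : ℕ → X} {q r : ℕ → ℕ} {c : ℕ → ℕ → ℝ}
    (hqr : ∀ j, q j < r j) (hrq : ∀ j, r j ≤ q (j + 1)) (hy : ∀ j, y j ≠ 0)
    (hyc : ∀ j, y j = ∑ l ∈ Finset.Ico (q j) (r j), c j l • x l) : IsBlockBasisOf x y := by
  have hq : StrictMono q := strictMono_nat_of_lt_succ fun j => (hqr j).trans_le (hrq j)
  obtain ⟨d, hd, hd0⟩ := exists_glued_coeff hq hrq c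
  refine ⟨q, d, hq, hy, fun j => ?_⟩
  rw [hyc j, ← Finset.sum_Ico_consecutive _ (hqr j).le (hrq j)]
  have hzero : ∑ l ∈ Finset.Ico (r j) (q (j + 1)), d l • x l = 0 := by
    refine Finset.sum_eq_zero fun l hl => ?_
    rw [Finset.mem_Ico] at hl
    rw [hd0 l, zero_smul]
    intro s hs
    have hsj : s < j + 1 := hq.lt_iff_lt.1 (hs.trans_lt hl.2)
    rcases (Nat.lt_succ_iff.1 hsj).lt_or_eq with h | rfl
    · exact (hrq s).trans ((hq.monotone h).trans ((hqr j).le.trans hl.1))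
    · exact hl.1
  rw [hzero, add_zero]
  refine Finset.sum_congr rfl fun l hl => ?_
  rw [Finset.mem_Ico] at hl
  rw [hd j l hl.1 hl.2]

/-- A block basis of a `C`-basic sequence is `C`-basic. -/
theorem IsBlockBasisOf.isCBasic {C : ℝ} {x y : ℕ → X} (h : IsBlockBasisOf x y)
    (hx : IsCBasic C x) : IsCBasic C y := by
  obtain ⟨p, b, hp, hy, hyb⟩ := h
  refine ⟨hy, fun n m hnm a => ?_⟩
  obtain ⟨d, hd, hd0⟩ :=
    exists_glued_coeff (r := fun j => p (j + 1)) hp (fun _ => le_rfl) fun j l => a j * b l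
  have key : ∀ n, ∑ i ∈ Finset.range n, a i • y i = ∑ l ∈ Finset.range (p n), d l • x l := by
    intro n
    induction n with
    | zero =>
      rw [Finset.sum_range_zero]
      refine (Finset.sum_eq_zero fun l hl => ?_).symm
      rw [hd0 l, zero_smul]
      intro j hj
      have := hp.monotone (Nat.zero_le j)
      rw [Finset.mem_range] at hl
      omega
    | succ n ih =>
      rw [Finset.sum_range_succ, ih,
        ← Finset.sum_range_add_sum_Ico _ (hp.monotone n.le_succ), hyb n, Finset.smul_sum]
      congr 1
      refine Finset.sum_congr rfl fun l hl => ?_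
      rw [Finset.mem_Ico] at hl
      rw [hd n l hl.1 hl.2, mul_smul]
  rw [key n, key m]
  exact hx.2 _ _ (hp hnm) d

theorem IsCBasic.upTo {C : ℝ} {y : ℕ → X} (h : IsCBasic C y) (m : ℕ) : IsCBasicUpTo C m y :=
  ⟨fun j _ => h.1 j, fun n k hnk _ => h.2 n k hnk⟩

theorem IsBlockBasisOf.upTo {x y : ℕ → X} (h : IsBlockBasisOf x y) (m : ℕ) :
    IsBlockBasisUpTo m x y := by
  obtain ⟨p, b, hp, hy, hyb⟩ := h
  exact ⟨p, b, hp, fun j _ => hy j, fun j _ => hyb j⟩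

/-- Along a sufficiently sparse sequence `k`, the `k i`-th interval of each of the rows
`0, …, i` ends before the `k (i + 1)`-th interval of any row begins. -/
theorem exists_strictMono_separating (p : ℕ → ℕ → ℕ) (hp : ∀ n, StrictMono (p n)) :
    ∃ k : ℕ → ℕ, StrictMono k ∧
      ∀ s i i' t, s ≤ i → i < i' → p s (k i + 1) ≤ p t (k i') := by
  let f : ℕ → ℕ → ℕ := fun i a =>
    max (a + 1) ((Finset.range (i + 1)).sup fun s => p s (a + 1))
  let k : ℕ → ℕ := fun i => Nat.rec 0 f i
  have hk : StrictMono k := strictMono_nat_of_lt_succ fun i => le_max_left (k i + 1) _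
  refine ⟨k, hk, fun s i i' t hs hi => ?_⟩
  calc p s (k i + 1) ≤ (Finset.range (i + 1)).sup fun s => p s (k i + 1) :=
        Finset.le_sup (f := fun s => p s (k i + 1)) (Finset.mem_range.2 (by omega))
    _ ≤ k (i + 1) := le_max_right (k i + 1) _
    _ ≤ k i' := hk.monotone hi
    _ ≤ p t (k i') := (hp t).le_apply

/-- Lemma 3.2 b): an array whose rows are normalized block bases of a basic sequence `x0`
admits a subarray which is a block basic array of `x0`. -/
theorem stmt_3 {X : Type*} [NormedAddCommGroup X] [NormedSpace ℝ X] [CompleteSpace X]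
    (x0 : ℕ → X) (hx0 : ∃ C : ℝ, IsCBasic C x0)
    (x : ℕ → ℕ → X) (hrows : ∀ n, Normalized (x n) ∧ IsBlockBasisOf x0 (x n)) :
    ∃ k : ℕ → ℕ, StrictMono k ∧ IsBlockBasicArray x0 fun n i => x n (k i) := by
  obtain ⟨C, hC⟩ := hx0
  choose hnorm p b hp hne hxb using hrows
  obtain ⟨k, hk, hsep⟩ := exists_strictMono_separating p hp
  have hrow : ∀ n, IsBlockBasisOf x0 fun i => x n (k i) := fun n =>
    isBlockBasisOf_of_intervals (q := fun i => p n (k i)) (r := fun i => p n (k i + 1))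
      (c := fun _ => b n) (fun i => hp n (Nat.lt_succ_self _))
      (fun i => (hp n).monotone (hk i.lt_succ_self)) (fun i => hne n (k i))
      (fun i => hxb n (k i))
  have hdiag : ∀ i : ℕ → ℕ, StrictMono i → IsBlockBasisOf x0 fun j => x j (k (i j)) :=
    fun i hi =>
      isBlockBasisOf_of_intervals (q := fun j => p j (k (i j)))
        (r := fun j => p j (k (i j) + 1)) (c := b) (fun j => hp j (Nat.lt_succ_self _))
        (fun j => hsep _ _ _ _ hi.le_apply (hi j.lt_succ_self)) (fun j => hne j _)
        (fun j => hxb j _)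
  exact ⟨k, hk,
    ⟨C, fun n => ⟨fun i => hnorm n (k i), (hrow n).isCBasic hC⟩,
      fun m i hi _ => ((hdiag i hi).isCBasic hC).upTo m⟩,
    hrow, fun m i hi _ => (hdiag i hi).upTo m⟩
end

section
/- Let X be a Banach space and let (e_i)_{i∈ω} be an asymptotic model of X generated by a basic array (x_i^n)_{n,i∈ω} which is either weakly null (every row (x_i^n)_{i∈ω} is weakly null) or a block basic array with respect to some basic sequence in X. Then every normalized block basis (f_i)_{i∈ω} of (e_i)_{i∈ω} is also an asymptotic model of X. -/
open Filter Finset Topology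

variable {X : Type*} [NormedAddCommGroup X] [NormedSpace ℝ X]
variable {E : Type*} [NormedAddCommGroup E] [NormedSpace ℝ E]

/-- `(x i)` is weakly null. -/
def WeaklyNull (x : ℕ → X) : Prop :=
  ∀ f : X →L[ℝ] ℝ, Filter.Tendsto (fun i => f (x i)) Filter.atTop (nhds 0)

/-- `IteratedLimit n f L`: the iterated limit `lim_{i₀→∞} ⋯ lim_{i_{n-1}→∞} f (i₀, …, i_{n-1})`
exists and equals `L`. -/
def IteratedLimit : ∀ n : ℕ, ((Fin n → ℕ) → ℝ) → ℝ → Prop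
  | 0, f, L => f (fun i => i.elim0) = L
  | n + 1, f, L => ∃ g : ℕ → ℝ,
      (∀ i₀ : ℕ, IteratedLimit n (fun t => f (Fin.cons i₀ t)) (g i₀)) ∧
      Filter.Tendsto g Filter.atTop (nhds L)

/-- The array `y` in `X` generates the asymptotic model `e`: all the iterated limits
`lim_{i₀→∞} ⋯ lim_{i_{n-1}→∞} ‖∑_{j<n} b j • y j (i j)‖` exist and equal
`‖∑_{j<n} b j • e j‖`. -/
def GeneratesAsymptoticModel (y : ℕ → ℕ → X) (e : ℕ → E) : Prop :=
  ∀ (n : ℕ) (b : ℕ → ℝ),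
    IteratedLimit n (fun t => ‖∑ j : Fin n, b (j : ℕ) • y (j : ℕ) (t j)‖)
      ‖∑ j ∈ Finset.range n, b j • e j‖

/-- `e` is an asymptotic model of `X`: it is a normalized basic sequence generated by
some basic array in `X`. -/
def IsAsymptoticModel (X : Type*) [NormedAddCommGroup X] [NormedSpace ℝ X]
    {E : Type*} [NormedAddCommGroup E] [NormedSpace ℝ E] (e : ℕ → E) : Prop :=
  Normalized e ∧ (∃ C : ℝ, IsCBasic C e) ∧
    ∃ y : ℕ → ℕ → X, IsBasicArray y ∧ GeneratesAsymptoticModel y e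

/-! ### Iterated limits over sequences of indices -/

/-- The iterated limit of `φ` in the coordinates `s, …, s + d - 1`, the other ones being those
of `t`. -/
def SeqLimit : ℕ → ℕ → ((ℕ → ℕ) → ℝ) → (ℕ → ℕ) → ℝ → Prop
  | _, 0, φ, t, L => φ t = L
  | s, d + 1, φ, t, L => ∃ g : ℕ → ℝ,
      (∀ i, SeqLimit (s + 1) d φ (Function.update t s i) (g i)) ∧ Tendsto g atTop (𝓝 L)

/-- Overwrite the coordinates `s, …, s + d - 1` of `t` by those of `τ`. -/
def overwrite (t : ℕ → ℕ) (s d : ℕ) (τ : Fin d → ℕ) : ℕ → ℕ := fun l =>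
  if h : s ≤ l ∧ l < s + d then τ ⟨l - s, by omega⟩ else t l

theorem overwrite_cons (t : ℕ → ℕ) (s d i : ℕ) (τ : Fin d → ℕ) :
    overwrite t s (d + 1) (Fin.cons i τ) = overwrite (Function.update t s i) (s + 1) d τ := by
  funext l
  unfold overwrite
  rcases lt_trichotomy l s with h | rfl | h
  · rw [dif_neg (by omega), dif_neg (by omega), Function.update_of_ne (by omega)]
  · rw [dif_pos (by omega), dif_neg (by omega), Function.update_self]
    have : (⟨l - l, by omega⟩ : Fin (d + 1)) = 0 := by ext; simp
    rw [this, Fin.cons_zero]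
  · by_cases h' : l < s + (d + 1)
    · rw [dif_pos (by omega), dif_pos (by omega)]
      have : (⟨l - s, by omega⟩ : Fin (d + 1)) = Fin.succ ⟨l - (s + 1), by omega⟩ := by
        ext; simp; omega
      rw [this, Fin.cons_succ]
    · rw [dif_neg (by omega), dif_neg (by omega), Function.update_of_ne (by omega)]

theorem seqLimit_iff_iteratedLimit (d : ℕ) : ∀ (s : ℕ) (φ : (ℕ → ℕ) → ℝ) (t : ℕ → ℕ) (L : ℝ),
    SeqLimit s d φ t L ↔ IteratedLimit d (fun τ => φ (overwrite t s d τ)) L := by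
  induction d with
  | zero =>
    intro s φ t L
    have : overwrite t s 0 (fun i => i.elim0) = t := by
      funext l; unfold overwrite; rw [dif_neg (by omega)]
    simp [SeqLimit, IteratedLimit, this]
  | succ d ih =>
    intro s φ t L
    simp only [SeqLimit, IteratedLimit, ih, overwrite_cons]

theorem seqLimit_norm_iff {y : ℕ → ℕ → X} {n : ℕ} {b : ℕ → ℝ} {L : ℝ} (t : ℕ → ℕ) :
    SeqLimit 0 n (fun τ => ‖∑ j ∈ range n, b j • y j (τ j)‖) t L ↔
      IteratedLimit n (fun τ => ‖∑ j : Fin n, b (j : ℕ) • y (j : ℕ) (τ j)‖) L := by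
  rw [seqLimit_iff_iteratedLimit]
  have : ∀ τ : Fin n → ℕ, ∑ j ∈ range n, b j • y j (overwrite t 0 n τ j) =
      ∑ j : Fin n, b (j : ℕ) • y (j : ℕ) (τ j) := by
    intro τ
    rw [Finset.sum_range]
    refine Finset.sum_congr rfl fun j _ => ?_
    have : overwrite t 0 n τ j = τ j := by
      unfold overwrite; rw [dif_pos (by omega)]; rfl
    rw [this]
  simp only [this]

theorem SeqLimit.unique {d : ℕ} : ∀ {s : ℕ} {φ : (ℕ → ℕ) → ℝ} {t : ℕ → ℕ} {L L' : ℝ},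
    SeqLimit s d φ t L → SeqLimit s d φ t L' → L = L' := by
  induction d with
  | zero => intro s φ t L L' h h'; exact h.symm.trans h'
  | succ d ih =>
    rintro s φ t L L' ⟨g, hg, hL⟩ ⟨g', hg', hL'⟩
    obtain rfl : g = g' := funext fun i => ih (hg i) (hg' i)
    exact tendsto_nhds_unique hL hL'

theorem SeqLimit.exists_inner {n : ℕ} {φ : (ℕ → ℕ) → ℝ}
    (h : ∀ t, ∃ L, SeqLimit 0 n φ t L) :
    ∀ s d, s + d = n → ∀ t, ∃ L, SeqLimit s d φ t L := by
  intro s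
  induction s with
  | zero => intro d hd; obtain rfl : d = n := by omega
            exact h
  | succ s ih =>
    intro d hd t
    obtain ⟨L, g, hg, -⟩ := ih (d + 1) (by omega) t
    exact ⟨g (t s), by simpa using hg (t s)⟩

/-- `N a n s t` is the iterated limit of `‖∑_{l<n} a l • x l (t l)‖` in the coordinates
`s, …, n - 1` of `t`. -/
structure IsPartialLimit (x : ℕ → ℕ → X) (N : (ℕ → ℝ) → ℕ → ℕ → (ℕ → ℕ) → ℝ) : Prop where
  top : ∀ a n t, N a n n t = ‖∑ l ∈ range n, a l • x l (t l)‖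
  tendsto : ∀ a n s t, s < n →
    Tendsto (fun i => N a n (s + 1) (Function.update t s i)) atTop (𝓝 (N a n s t))

theorem GeneratesAsymptoticModel.exists_isPartialLimit {x : ℕ → ℕ → X} {e : ℕ → E}
    (h : GeneratesAsymptoticModel x e) :
    ∃ N, IsPartialLimit x N ∧ ∀ a n t, N a n 0 t = ‖∑ l ∈ range n, a l • e l‖ := by
  have key : ∀ (a : ℕ → ℝ) (n s : ℕ) (t : ℕ → ℕ), ∃ L, s ≤ n →
      SeqLimit s (n - s) (fun τ => ‖∑ j ∈ range n, a j • x j (τ j)‖) t L := by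
    intro a n s t
    by_cases hs : s ≤ n
    · obtain ⟨L, hL⟩ := SeqLimit.exists_inner
        (fun t => ⟨_, (seqLimit_norm_iff t).2 (h n a)⟩) s (n - s) (by omega) t
      exact ⟨L, fun _ => hL⟩
    · exact ⟨0, fun h => absurd h hs⟩
  choose N hN using key
  refine ⟨N, ⟨fun a n t => ?_, fun a n s t hs => ?_⟩, fun a n t => ?_⟩
  · have := hN a n n t le_rfl
    rw [Nat.sub_self] at this
    exact this.symm
  · have h1 := hN a n s t hs.le
    obtain ⟨d, hd⟩ : ∃ d, n - s = d + 1 := ⟨n - s - 1, by omega⟩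
    rw [hd] at h1
    obtain ⟨g, hg, hL⟩ := h1
    convert hL using 2 with i
    have h2 := hN a n (s + 1) (Function.update t s i) hs
    rw [show n - (s + 1) = d by omega] at h2
    exact h2.unique (hg i)
  · exact (hN a n 0 t (Nat.zero_le _)).unique ((seqLimit_norm_iff t).2 (h n a))

namespace IsPartialLimit

variable {x : ℕ → ℕ → X} {N : (ℕ → ℝ) → ℕ → ℕ → (ℕ → ℕ) → ℝ}

theorem abs_sub_le (hN : IsPartialLimit x N) (hx : ∀ l, Normalized (x l)) (a a' : ℕ → ℝ)
    {n s : ℕ} (hs : s ≤ n) (t : ℕ → ℕ) :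
    |N a n s t - N a' n s t| ≤ ∑ l ∈ range n, |a l - a' l| := by
  induction hs using Nat.decreasingInduction generalizing t with
  | self =>
    rw [hN.top, hN.top]
    refine (abs_norm_sub_norm_le _ _).trans ?_
    rw [← Finset.sum_sub_distrib]
    refine (norm_sum_le _ _).trans (Finset.sum_le_sum fun l _ => ?_)
    rw [← sub_smul, norm_smul, hx l, mul_one, Real.norm_eq_abs]
  | of_succ s hs ih =>
    exact le_of_tendsto ((hN.tendsto a n s t hs).sub (hN.tendsto a' n s t hs)).abs
      (Eventually.of_forall fun i => ih _)

theorem congr (hN : IsPartialLimit x N) (a : ℕ → ℝ)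
    {n s : ℕ} (hs : s ≤ n) {t t' : ℕ → ℕ} (h : ∀ l < s, a l ≠ 0 → t l = t' l) :
    N a n s t = N a n s t' := by
  induction hs using Nat.decreasingInduction generalizing t t' with
  | self =>
    rw [hN.top, hN.top]
    congr 1
    refine Finset.sum_congr rfl fun l hl => ?_
    by_cases ha : a l = 0
    · simp [ha]
    · rw [h l (Finset.mem_range.1 hl) ha]
  | of_succ s hs ih =>
    refine tendsto_nhds_unique (hN.tendsto a n s t hs) ?_
    convert hN.tendsto a n s t' hs using 2 with i
    refine ih fun l hl ha => ?_
    by_cases hls : l = s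
    · subst hls; simp
    · rw [Function.update_of_ne hls, Function.update_of_ne hls, h l (by omega) ha]

theorem eq_zero_of_vanish (hN : IsPartialLimit x N) (a : ℕ → ℝ)
    {n s : ℕ} (hs : s ≤ n) (h : ∀ l < s, a l = 0) (t : ℕ → ℕ) : N a n s t = N a n 0 t := by
  induction s with
  | zero => rfl
  | succ s ih =>
    rw [← ih (by omega) fun l hl => h l (by omega)]
    refine tendsto_nhds_unique ?_ (hN.tendsto a n s t hs)
    refine tendsto_const_nhds.congr fun i => ?_
    exact hN.congr a hs fun l hl ha => absurd (h l hl) ha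

end IsPartialLimit

/-- The filter of the iterated limits `lim_{i_s→∞} ⋯ lim_{i_{s+d-1}→∞}`. -/
def iterFilter : ℕ → ℕ → Filter (ℕ → ℕ)
  | _, 0 => pure 0
  | s, d + 1 => atTop.bind fun i => (iterFilter (s + 1) d).map fun τ => Function.update τ s i

theorem eventually_iterFilter_succ {s d : ℕ} {P : (ℕ → ℕ) → Prop} :
    (∀ᶠ τ in iterFilter s (d + 1), P τ) ↔
      ∀ᶠ i in atTop, ∀ᶠ τ in iterFilter (s + 1) d, P (Function.update τ s i) := Iff.rfl

instance iterFilter_neBot (s d : ℕ) : (iterFilter s d).NeBot := by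
  induction d generalizing s with
  | zero => exact pure_neBot
  | succ d ih =>
    rw [neBot_iff]
    intro h
    have : ∀ᶠ _ in iterFilter s (d + 1), False := by rw [h]; exact eventually_bot
    obtain ⟨_, hi⟩ := (eventually_iterFilter_succ.1 this).exists
    exact (ih (s + 1)).ne (eventually_false_iff_eq_bot.1 hi)

theorem tendsto_eval_iterFilter (s d l : ℕ) (h : l ∈ Finset.Ico s (s + d)) :
    Tendsto (fun τ : ℕ → ℕ => τ l) (iterFilter s d) atTop := by
  rw [tendsto_atTop]
  intro M
  induction d generalizing s with
  | zero => simp at h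
  | succ d ih =>
    rw [eventually_iterFilter_succ]
    rw [Finset.mem_Ico] at h
    by_cases hl : l = s
    · subst hl
      filter_upwards [eventually_ge_atTop M] with i hi
      simpa using hi
    · refine Eventually.of_forall fun i => ?_
      simpa [Function.update_of_ne hl] using ih (s + 1) (by rw [Finset.mem_Ico]; omega)

/-- The sequence which is `t` below `s` and `τ` from `s` on. -/
def glue (s : ℕ) (t τ : ℕ → ℕ) : ℕ → ℕ := fun l => if l < s then t l else τ l

theorem glue_update (s i : ℕ) (t τ : ℕ → ℕ) :
    glue s t (Function.update τ s i) = glue (s + 1) (Function.update t s i) τ := by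
  funext l
  unfold glue
  rcases lt_trichotomy l s with h | rfl | h
  · rw [if_pos h, if_pos (by omega), Function.update_of_ne (by omega)]
  · simp
  · rw [if_neg (by omega), if_neg (by omega), Function.update_of_ne (by omega)]

theorem IsPartialLimit.tendsto_iterFilter {x : ℕ → ℕ → X}
    {N : (ℕ → ℝ) → ℕ → ℕ → (ℕ → ℕ) → ℝ} (hN : IsPartialLimit x N) (a : ℕ → ℝ) (n d : ℕ) :
    ∀ (s : ℕ) (t : ℕ → ℕ), s + d ≤ n →
      Tendsto (fun τ => N a n (s + d) (glue s t τ)) (iterFilter s d) (𝓝 (N a n s t)) := by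
  induction d with
  | zero =>
    intro s t hs
    have : ∀ τ, N a n (s + 0) (glue s t τ) = N a n s t := fun τ =>
      hN.congr a hs fun l hl _ => if_pos hl
    simp only [this]
    exact tendsto_const_nhds
  | succ d ih =>
    intro s t hs
    rw [(closed_nhds_basis _).tendsto_right_iff]
    rintro U ⟨hU, hUc⟩
    simp only [id]
    rw [eventually_iterFilter_succ]
    have h1 := (hN.tendsto a n s t (by omega)).eventually (interior_mem_nhds.2 hU)
    filter_upwards [h1] with i hi
    have h2 := (ih (s + 1) (Function.update t s i) (by omega)).eventually
      (mem_interior_iff_mem_nhds.1 hi)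
    filter_upwards [h2] with τ hτ
    rw [glue_update, show s + (d + 1) = s + 1 + d by omega]
    exact hτ

/-! ### Basic sequences -/

/-- Mazur's lemma: the hypotheses hold eventually along normalized weakly null sequences. -/
theorem exists_finite_dual_almost_orthogonal {F : Set X} (hF : F.Finite) {θ : ℝ} (hθ : 1 < θ) :
    ∃ D : Set (X →L[ℝ] ℝ), D.Finite ∧ ∃ δ > 0, ∀ y : X, ‖y‖ = 1 → (∀ g ∈ D, |g y| < δ) →
      ∀ v ∈ Submodule.span ℝ F, ∀ a : ℝ, ‖v‖ ≤ θ * ‖v + a • y‖ := by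
  have hfin : FiniteDimensional ℝ (Submodule.span ℝ F) := FiniteDimensional.span_of_finite ℝ hF
  have hprop : ProperSpace (Submodule.span ℝ F) := FiniteDimensional.proper_real _
  set δ : ℝ := (1 - θ⁻¹) / 4 with hδ
  have hθ' : θ⁻¹ < 1 := inv_lt_one_of_one_lt₀ hθ
  have hδ0 : 0 < δ := by rw [hδ]; linarith
  obtain ⟨T, -, hTf, hT⟩ :=
    (isCompact_sphere (0 : Submodule.span ℝ F) 1).finite_cover_balls hδ0
  choose g hg1 hg2 using fun w : Submodule.span ℝ F => exists_dual_vector'' ℝ (w : X)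
  have hgb : ∀ w z, |g w z| ≤ ‖z‖ := fun w z => by
    simpa using (g w).le_of_opNorm_le (hg1 w) z
  refine ⟨g '' T, hTf.image g, δ, hδ0, fun y hy hD => ?_⟩
  have unit : ∀ v ∈ Submodule.span ℝ F, ‖v‖ = 1 → ∀ a : ℝ, 1 ≤ θ * ‖v + a • y‖ := by
    intro v hv hv1 a
    by_cases ha : 2 ≤ |a|
    · have h1 : ‖a • y‖ ≤ ‖v + a • y‖ + ‖v‖ := by
        simpa using norm_sub_le (v + a • y) v
      rw [norm_smul, hy, Real.norm_eq_abs, hv1] at h1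
      nlinarith
    · obtain ⟨w, hwT, hw⟩ := Set.mem_iUnion₂.1
        (hT (show (⟨v, hv⟩ : Submodule.span ℝ F) ∈ Metric.sphere 0 1 by simpa using hv1))
      have hvw : ‖v - w‖ < δ := by simpa [dist_eq_norm] using hw
      have h1 := hgb w (v + a • y)
      have h2 := hgb w (v - w)
      have h3 : |a| * |g w y| ≤ 2 * δ :=
        mul_le_mul (not_le.1 ha).le (hD _ ⟨w, hwT, rfl⟩).le (abs_nonneg _) (by norm_num)
      rw [← abs_mul] at h3
      have hww : 1 - δ < ‖(w : X)‖ := by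
        have h4 : ‖v‖ ≤ ‖v - w‖ + ‖(w : X)‖ := by simpa using norm_add_le (v - w) (w : X)
        linarith
      have h5 : g w (v + a • y) = g w (v - w) + ‖(w : X)‖ + a * g w y := by
        have := hg2 w
        simp only [map_add, map_sub, map_smul, smul_eq_mul] at this ⊢
        rw [this]; simp
      have h6 := neg_abs_le (g w (v - w))
      have h7 := neg_abs_le (a * g w y)
      have h8 := le_abs_self (g w (v + a • y))
      have h9 : θ⁻¹ ≤ ‖v + a • y‖ := by linarith
      calc (1 : ℝ) = θ * θ⁻¹ := (mul_inv_cancel₀ (by positivity)).symm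
        _ ≤ θ * ‖v + a • y‖ := by gcongr
  intro v hv a
  by_cases hv0 : v = 0
  · simp only [hv0, norm_zero]; positivity
  have hvn : 0 < ‖v‖ := norm_pos_iff.2 hv0
  have h1 := unit (‖v‖⁻¹ • v) (Submodule.smul_mem _ _ hv)
    (by rw [norm_smul, norm_inv, norm_norm, inv_mul_cancel₀ hvn.ne']) (‖v‖⁻¹ * a)
  rw [mul_smul, ← smul_add, norm_smul, norm_inv, norm_norm] at h1
  calc ‖v‖ = ‖v‖ * 1 := (mul_one _).symm
    _ ≤ ‖v‖ * (θ * (‖v‖⁻¹ * ‖v + a • y‖)) := by gcongr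
    _ = θ * ‖v + a • y‖ := by field_simp

theorem isCBasic_of_forall_isCBasicUpTo {K : ℝ} {z : ℕ → X} (h : ∀ m, IsCBasicUpTo K m z) :
    IsCBasic K z :=
  ⟨fun i => (h (i + 1)).1 i (Nat.lt_succ_self i), fun n m hnm => (h m).2 n m hnm le_rfl⟩

/-- A relation between finite sets of vectors, indices and vectors which enforces
sequences to be basic. -/
def ForcesBasic (K : ℝ) (R : Set X → ℕ → X → Prop) : Prop :=
  ∀ (m : ℕ) (z : ℕ → X) (i : ℕ → ℕ), StrictMono i → (∀ r < m, ‖z r‖ = 1) →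
    (∀ r < m, ∃ F, (∀ r' < r, z r' ∈ F) ∧ R F (i r) (z r)) → IsCBasicUpTo K m z

/-- An increasing sequence with values in `[1, 2]`. -/
noncomputable def mazurConst (i : ℕ) : ℝ := 2 - 1 / ((i : ℝ) + 1)

theorem mazurConst_strictMono : StrictMono mazurConst := by
  refine strictMono_nat_of_lt_succ fun i => ?_
  unfold mazurConst
  have : (1 : ℝ) / (((i + 1 : ℕ) : ℝ) + 1) < 1 / ((i : ℝ) + 1) := by
    apply one_div_lt_one_div_of_lt <;> push_cast <;> linarith [(Nat.cast_nonneg i : (0 : ℝ) ≤ i)]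
  linarith

theorem one_le_mazurConst (i : ℕ) : 1 ≤ mazurConst i := by
  have := mazurConst_strictMono.monotone (Nat.zero_le i)
  norm_num [mazurConst] at this ⊢
  exact this

theorem mazurConst_le_two (i : ℕ) : mazurConst i ≤ 2 := by
  unfold mazurConst
  have : (0 : ℝ) ≤ 1 / ((i : ℝ) + 1) := by positivity
  linarith

theorem forcesBasic_mazur : ForcesBasic (X := X) 2 fun F i y =>
    ∀ v ∈ Submodule.span ℝ F, ∀ a : ℝ,
      mazurConst i * ‖v‖ ≤ mazurConst (i + 1) * ‖v + a • y‖ := by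
  intro m z i hi hz hR
  refine ⟨fun j hj h0 => by simpa [h0] using hz j hj, fun n k hnk hkm a => ?_⟩
  have key : mazurConst (i n) * ‖∑ r ∈ range n, a r • z r‖ ≤
      mazurConst (i k) * ‖∑ r ∈ range k, a r • z r‖ := by
    induction k, hnk.le using Nat.le_induction with
    | base => exact le_rfl
    | succ k hnk' ih =>
      have hprev : mazurConst (i n) * ‖∑ r ∈ range n, a r • z r‖ ≤
          mazurConst (i k) * ‖∑ r ∈ range k, a r • z r‖ := by
        rcases hnk'.eq_or_lt with rfl | hlt
        · exact le_rfl
        · exact ih hlt (by omega)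
      obtain ⟨F, hF, h⟩ := hR k (by omega)
      have hstep := h (∑ r ∈ range k, a r • z r) (Submodule.sum_mem _ fun r hr =>
        Submodule.smul_mem _ _ (Submodule.subset_span (hF r (Finset.mem_range.1 hr)))) (a k)
      rw [← Finset.sum_range_succ] at hstep
      refine hprev.trans (hstep.trans ?_)
      gcongr
      exact mazurConst_strictMono.monotone (hi (Nat.lt_succ_self k))
  calc ‖∑ r ∈ range n, a r • z r‖ ≤ mazurConst (i n) * ‖∑ r ∈ range n, a r • z r‖ :=
        le_mul_of_one_le_left (norm_nonneg _) (one_le_mazurConst _)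
    _ ≤ mazurConst (i k) * ‖∑ r ∈ range k, a r • z r‖ := key
    _ ≤ 2 * ‖∑ r ∈ range k, a r • z r‖ := by gcongr; exact mazurConst_le_two _

theorem exists_eq_sum_range_of_mem_span {x0 : ℕ → X} {s : Set ℕ} {v : X}
    (hv : v ∈ Submodule.span ℝ (x0 '' s)) :
    ∃ c : ℕ → ℝ, (∀ l ∉ s, c l = 0) ∧ ∃ L, ∀ m ≥ L, v = ∑ l ∈ range m, c l • x0 l := by
  obtain ⟨c, hc, rfl⟩ := (Finsupp.mem_span_image_iff_linearCombination ℝ).1 hv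
  refine ⟨c, fun l hl => ?_, c.support.sup id + 1, fun m hm => ?_⟩
  · by_contra h
    exact hl ((Finsupp.mem_supported _ _).1 hc (Finsupp.mem_support_iff.2 h))
  · rw [Finsupp.linearCombination_apply, Finsupp.sum]
    refine Finset.sum_subset (fun l hl => ?_) fun l _ hl => ?_
    · have : l ≤ c.support.sup id := Finset.le_sup (f := id) hl
      exact Finset.mem_range.2 (by omega)
    · simp [Finsupp.notMem_support_iff.1 hl]

theorem IsCBasic.norm_le {C : ℝ} {x0 : ℕ → X} (h : IsCBasic C x0) {M : ℕ} {v w : X}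
    (hv : v ∈ Submodule.span ℝ (x0 '' Set.Iio M))
    (hw : w ∈ Submodule.span ℝ (x0 '' Set.Ici M)) : ‖v‖ ≤ C * ‖v + w‖ := by
  obtain ⟨c, hc, L, hL⟩ := exists_eq_sum_range_of_mem_span hv
  obtain ⟨c', hc', L', hL'⟩ := exists_eq_sum_range_of_mem_span hw
  have h1 := h.2 M (M + L + L' + 1) (by omega) (fun l => c l + c' l)
  have e1 : ∑ l ∈ range M, (c l + c' l) • x0 l = v := by
    rw [hL (M + L) (by omega)]
    rw [← Finset.sum_range_add_sum_Ico _ (show M ≤ M + L by omega)]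
    rw [Finset.sum_eq_zero (s := Finset.Ico M (M + L)), add_zero]
    · refine Finset.sum_congr rfl fun l hl => ?_
      rw [hc' l (by simpa using hl), add_zero]
    · intro l hl
      rw [hc l (by simpa using (Finset.mem_Ico.1 hl).1), zero_smul]
  have e2 : ∑ l ∈ range (M + L + L' + 1), (c l + c' l) • x0 l = v + w := by
    simp only [add_smul, Finset.sum_add_distrib]
    rw [← hL _ (by omega), ← hL' _ (by omega)]
  rwa [e1, e2] at h1

theorem IsCBasic.forcesBasic {C : ℝ} {x0 : ℕ → X} (h : IsCBasic C x0) :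
    ForcesBasic C fun F _ y => ∃ M, F ⊆ Submodule.span ℝ (x0 '' Set.Iio M) ∧
      y ∈ Submodule.span ℝ (x0 '' Set.Ici M) := by
  intro m z i _ hz hR
  have hmono : ∀ {M M' : ℕ}, M ≤ M' →
      Submodule.span ℝ (x0 '' Set.Iio M) ≤ Submodule.span ℝ (x0 '' Set.Iio M') ∧
      Submodule.span ℝ (x0 '' Set.Ici M') ≤ Submodule.span ℝ (x0 '' Set.Ici M) := fun hM =>
    ⟨Submodule.span_mono (Set.image_mono (Set.Iio_subset_Iio hM)),
      Submodule.span_mono (Set.image_mono (Set.Ici_subset_Ici.2 hM))⟩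
  refine ⟨fun j hj h0 => by simpa [h0] using hz j hj, fun n k hnk hkm a => ?_⟩
  obtain ⟨F, hF, M, hFM, hzM⟩ := hR n (by omega)
  rw [← Finset.sum_range_add_sum_Ico _ hnk.le]
  refine h.norm_le (M := M) (Submodule.sum_mem _ fun r hr =>
    Submodule.smul_mem _ _ (hFM (hF r (Finset.mem_range.1 hr))))
    (Submodule.sum_mem _ fun r hr => Submodule.smul_mem _ _ ?_)
  rw [Finset.mem_Ico] at hr
  rcases hr.1.eq_or_lt with rfl | hlt
  · exact hzM
  obtain ⟨F', hF', M', hFM', hzM'⟩ := hR r (by omega)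
  rcases le_total M M' with hM | hM
  · exact (hmono hM).2 hzM'
  · have h1 := h.norm_le ((hmono hM).1 (hFM' (hF' n hlt))) (neg_mem hzM)
    rw [add_neg_cancel, norm_zero, mul_zero, hz n (by omega)] at h1
    linarith

/-! ### Blocks -/

theorem IsBlockBasisOf.exists_zero_start {e f : ℕ → E} (h : IsBlockBasisOf e f) :
    ∃ (p : ℕ → ℕ) (b : ℕ → ℝ), StrictMono p ∧ p 0 = 0 ∧
      ∀ j, f j = ∑ l ∈ Finset.Ico (p j) (p (j + 1)), b l • e l := by
  obtain ⟨p, b, hp, -, hf⟩ := h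
  refine ⟨fun j => if j = 0 then 0 else p j, fun l => if l < p 0 then 0 else b l, ?_, rfl, ?_⟩
  · refine strictMono_nat_of_lt_succ fun j => ?_
    have := hp (Nat.lt_succ_self j)
    rcases j with _ | j
    · simp at this ⊢; omega
    · simpa using this
  · intro j
    rw [hf j]
    have hb : ∀ l ∈ Finset.Ico (p j) (p (j + 1)), ¬ l < p 0 := fun l hl => by
      have := hp.monotone (Nat.zero_le j)
      rw [Finset.mem_Ico] at hl
      omega
    rcases j with _ | j
    · simp only [if_true, Nat.zero_add, Nat.one_ne_zero, if_false]
      rw [← Finset.sum_Ico_consecutive _ (Nat.zero_le (p 0)) (hp (Nat.zero_lt_one)).le,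
        Finset.sum_eq_zero (s := Finset.Ico 0 (p 0)), zero_add]
      · exact Finset.sum_congr rfl fun l hl => by rw [if_neg (hb l hl)]
      · intro l hl
        rw [if_pos (Finset.mem_Ico.1 hl).2, zero_smul]
    · simp only [Nat.add_one_ne_zero, if_false]
      exact Finset.sum_congr rfl fun l hl => by rw [if_neg (hb l hl)]

theorem sum_range_blocks {M : Type*} [AddCommMonoid M] {p : ℕ → ℕ} (hp : Monotone p)
    (hp0 : p 0 = 0) (g : ℕ → M) (n : ℕ) :
    ∑ l ∈ range (p n), g l = ∑ j ∈ range n, ∑ l ∈ Finset.Ico (p j) (p (j + 1)), g l := by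
  induction n with
  | zero => simp [hp0]
  | succ n ih =>
    rw [Finset.sum_range_succ, ← ih, Finset.sum_range_add_sum_Ico _ (hp (Nat.le_succ n))]

theorem sum_range_ite_smul {m n : ℕ} (h : m ≤ n) (b : ℕ → ℝ) (v : ℕ → X) :
    ∑ l ∈ range n, (if m ≤ l then b l else 0) • v l = ∑ l ∈ Finset.Ico m n, b l • v l := by
  rw [← Finset.sum_range_add_sum_Ico _ h, Finset.sum_eq_zero (s := range m), zero_add]
  · exact Finset.sum_congr rfl fun l hl => by rw [if_pos (Finset.mem_Ico.1 hl).1]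
  · intro l hl
    rw [if_neg (by rw [Finset.mem_range] at hl; omega), zero_smul]

/-- The index of the block `[p j, p (j + 1))` which contains `l`. -/
noncomputable def blockIndex (p : ℕ → ℕ) (l : ℕ) : ℕ := sInf {j | l < p (j + 1)}

theorem blockIndex_eq {p : ℕ → ℕ} (hp : Monotone p) {j l : ℕ}
    (hl : l ∈ Finset.Ico (p j) (p (j + 1))) : blockIndex p l = j := by
  rw [Finset.mem_Ico] at hl
  refine le_antisymm (Nat.sInf_le hl.2) (le_csInf ⟨j, hl.2⟩ fun i (hi : l < p (i + 1)) => ?_)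
  by_contra h
  have := hp (show i + 1 ≤ j by omega)
  omega

theorem blockIndex_lt {p : ℕ → ℕ} (hp0 : p 0 = 0) {s l : ℕ} (hl : l < p s) :
    blockIndex p l < s := by
  rcases s with _ | s
  · omega
  · exact Nat.lt_succ_of_le (Nat.sInf_le hl)

theorem sum_range_block_smul {p : ℕ → ℕ} (hp : Monotone p) (hp0 : p 0 = 0) (b c : ℕ → ℝ)
    (v : ℕ → ℕ → X) (n : ℕ) :
    ∑ l ∈ range (p n), (c (blockIndex p l) * b l) • v (blockIndex p l) l =
      ∑ j ∈ range n, c j • ∑ l ∈ Finset.Ico (p j) (p (j + 1)), b l • v j l := by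
  rw [sum_range_blocks hp hp0]
  refine Finset.sum_congr rfl fun j _ => ?_
  rw [Finset.smul_sum]
  refine Finset.sum_congr rfl fun l hl => ?_
  rw [blockIndex_eq hp hl, mul_smul]

theorem IsCBasic.of_blocks {C : ℝ} {e f : ℕ → E} (he : IsCBasic C e) (hf : Normalized f)
    {p : ℕ → ℕ} {b : ℕ → ℝ} (hp : StrictMono p) (hp0 : p 0 = 0)
    (hfb : ∀ j, f j = ∑ l ∈ Finset.Ico (p j) (p (j + 1)), b l • e l) : IsCBasic C f := by
  refine ⟨fun j h0 => by simpa [h0] using hf j, fun n m hnm a => ?_⟩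
  have key : ∀ n, ∑ j ∈ range n, a j • f j =
      ∑ l ∈ range (p n), (a (blockIndex p l) * b l) • e l := fun n => by
    rw [sum_range_block_smul hp.monotone hp0 b a (fun _ => e)]
    exact Finset.sum_congr rfl fun j _ => by rw [hfb j]
  rw [key, key]
  exact he.2 _ _ (hp hnm) _

/-- The vector `∑ b l • x l (τ l)`, the sum being over the `j`-th block. -/
def blockVec (p : ℕ → ℕ) (b : ℕ → ℝ) (x : ℕ → ℕ → X) (j : ℕ) (τ : ℕ → ℕ) : X :=
  ∑ l ∈ Finset.Ico (p j) (p (j + 1)), b l • x l (τ l)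

/-- The normalization of `blockVec`. -/
noncomputable def unitBlockVec (p : ℕ → ℕ) (b : ℕ → ℝ) (x : ℕ → ℕ → X) (j : ℕ) (τ : ℕ → ℕ) : X :=
  ‖blockVec p b x j τ‖⁻¹ • blockVec p b x j τ

theorem norm_unitBlockVec {p : ℕ → ℕ} {b : ℕ → ℝ} {x : ℕ → ℕ → X} {j : ℕ} {τ : ℕ → ℕ}
    (h : blockVec p b x j τ ≠ 0) : ‖unitBlockVec p b x j τ‖ = 1 := by
  rw [unitBlockVec, norm_smul, norm_inv, norm_norm, inv_mul_cancel₀ (norm_ne_zero_iff.2 h)]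

theorem unitBlockVec_mem {p : ℕ → ℕ} {b : ℕ → ℝ} {x : ℕ → ℕ → X} {S : Submodule ℝ X}
    {j : ℕ} {τ : ℕ → ℕ} (h : ∀ l ∈ Finset.Ico (p j) (p (j + 1)), x l (τ l) ∈ S) :
    unitBlockVec p b x j τ ∈ S :=
  S.smul_mem _ (S.sum_mem fun l hl => S.smul_mem _ (h l hl))

/-- The iterated limits over the indices in the `j`-th block. -/
def blockFilter (p : ℕ → ℕ) (j : ℕ) : Filter (ℕ → ℕ) := iterFilter (p j) (p (j + 1) - p j)

instance blockFilter_neBot (p : ℕ → ℕ) (j : ℕ) : (blockFilter p j).NeBot :=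
  iterFilter_neBot _ _

theorem tendsto_eval_blockFilter {p : ℕ → ℕ} {j l : ℕ}
    (h : l ∈ Finset.Ico (p j) (p (j + 1))) :
    Tendsto (fun τ : ℕ → ℕ => τ l) (blockFilter p j) atTop :=
  tendsto_eval_iterFilter _ _ _ (by rw [Finset.mem_Ico] at h ⊢; omega)

section

variable {x : ℕ → ℕ → X} {N : (ℕ → ℝ) → ℕ → ℕ → (ℕ → ℕ) → ℝ} {e f : ℕ → E}
  {p : ℕ → ℕ} {b : ℕ → ℝ}

theorem IsPartialLimit.tendsto_blockFilter (hN : IsPartialLimit x N) (hp : Monotone p)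
    (a : ℕ → ℝ) {n j : ℕ} (hn : p (j + 1) ≤ n) (t : ℕ → ℕ) :
    Tendsto (fun τ => N a n (p (j + 1)) (glue (p j) t τ)) (blockFilter p j)
      (𝓝 (N a n (p j) t)) := by
  have h : p j ≤ p (j + 1) := hp (Nat.le_succ j)
  have := hN.tendsto_iterFilter a n (p (j + 1) - p j) (p j) t (by omega)
  rwa [Nat.add_sub_cancel' h] at this

theorem IsPartialLimit.tendsto_norm_blockVec (hN : IsPartialLimit x N)
    (hN0 : ∀ a n t, N a n 0 t = ‖∑ l ∈ range n, a l • e l‖) (hp : Monotone p)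
    (hf : Normalized f) (hfb : ∀ j, f j = ∑ l ∈ Finset.Ico (p j) (p (j + 1)), b l • e l)
    (j : ℕ) : Tendsto (fun τ => ‖blockVec p b x j τ‖) (blockFilter p j) (𝓝 1) := by
  have hj : p j ≤ p (j + 1) := hp (Nat.le_succ j)
  set a : ℕ → ℝ := fun l => if p j ≤ l then b l else 0 with ha
  have h := hN.tendsto_blockFilter hp a (le_refl (p (j + 1))) 0
  rw [hN.eq_zero_of_vanish a hj (fun l hl => if_neg (by omega)), hN0, ha,
    sum_range_ite_smul hj, ← hfb, hf j] at h
  refine h.congr fun τ => ?_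
  rw [hN.top, sum_range_ite_smul hj b (fun l => x l (glue (p j) 0 τ l)), blockVec]
  congr 1
  refine Finset.sum_congr rfl fun l hl => ?_
  rw [glue, if_neg (by rw [Finset.mem_Ico] at hl; omega)]

theorem exists_rational_approx (a : ℕ → ℝ) (n : ℕ) {ε : ℝ} (hε : 0 < ε) :
    ∃ q : ℕ →₀ ℚ, ∑ l ∈ range n, |a l - q l| ≤ ε := by
  have h : ∀ l, ∃ q : ℚ, |a l - q| < ε / (n + 1) := fun l =>
    exists_rat_near (a l) (by positivity)
  choose q hq using h
  refine ⟨Finsupp.onFinset (range n) (fun l => if l < n then q l else 0) (by simp; tauto), ?_⟩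
  calc _ ≤ ∑ l ∈ range n, ε / (n + 1) := Finset.sum_le_sum fun l hl => by
        rw [Finsupp.onFinset_apply, if_pos (Finset.mem_range.1 hl)]
        exact (hq l).le
    _ = ε * (n / (n + 1)) := by simp; ring
    _ ≤ ε * 1 := by
        gcongr
        rw [div_le_one (by positivity)]; linarith
    _ = ε := mul_one ε

/-- A sequence whose terms are functions of the preceding ones. -/
noncomputable def historySeq {B : Type*} [Inhabited B] (c : ℕ → (ℕ → B) → B) (i : ℕ) : B :=
  c i fun i' => if _h : i' < i then historySeq c i' else default
termination_by i

theorem IsPartialLimit.exists_selection (hN : IsPartialLimit x N)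
    (hN0 : ∀ a n t, N a n 0 t = ‖∑ l ∈ range n, a l • e l‖) (hx : ∀ l, Normalized (x l))
    (hp : Monotone p) (hf : Normalized f)
    (hfb : ∀ j, f j = ∑ l ∈ Finset.Ico (p j) (p (j + 1)), b l • e l)
    {R : Set X → ℕ → X → Prop}
    (hR : ∀ F : Set X, F.Finite → F ⊆ Submodule.span ℝ (Set.range (Function.uncurry x)) →
      ∀ i j, ∀ᶠ τ in blockFilter p j, R F i (unitBlockVec p b x j τ)) :
    ∃ k : ℕ → ℕ → ℕ → ℕ, (∀ i j, blockVec p b x j (k i j) ≠ 0) ∧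
      (∀ j, Tendsto (fun i => ‖blockVec p b x j (k i j)‖) atTop (𝓝 1)) ∧
      (∀ a n j t, p (j + 1) ≤ n → Tendsto (fun i => N a n (p (j + 1)) (glue (p j) t (k i j)))
        atTop (𝓝 (N a n (p j) t))) ∧
      ∀ i j, ∃ F, (∀ i' < i, ∀ j', j' = j ∨ j' < i → unitBlockVec p b x j' (k i' j') ∈ F) ∧
        R F i (unitBlockVec p b x j (k i j)) := by
  obtain ⟨en, hen⟩ := exists_surjective_nat ((ℕ →₀ ℚ) × (ℕ →₀ ℕ) × ℕ)
  have hsel : ∀ (F : Set X) (i j : ℕ), ∃ τ : ℕ → ℕ,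
      (∀ r ≤ i, p (j + 1) ≤ (en r).2.2 →
        |N (fun l => (en r).1 l) (en r).2.2 (p (j + 1)) (glue (p j) (en r).2.1 τ) -
          N (fun l => (en r).1 l) (en r).2.2 (p j) (en r).2.1| < 1 / ((i : ℝ) + 1)) ∧
      |‖blockVec p b x j τ‖ - 1| < 1 / ((i : ℝ) + 1) ∧
      blockVec p b x j τ ≠ 0 ∧
      (F.Finite → F ⊆ Submodule.span ℝ (Set.range (Function.uncurry x)) →
        R F i (unitBlockVec p b x j τ)) := by
    intro F i j
    have hi : (0 : ℝ) < 1 / ((i : ℝ) + 1) := by positivity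
    have hlim := hN.tendsto_norm_blockVec hN0 hp hf hfb j
    have h1 : ∀ᶠ τ in blockFilter p j, ∀ r ∈ Set.Iic i, p (j + 1) ≤ (en r).2.2 →
        |N (fun l => (en r).1 l) (en r).2.2 (p (j + 1)) (glue (p j) (en r).2.1 τ) -
          N (fun l => (en r).1 l) (en r).2.2 (p j) (en r).2.1| < 1 / ((i : ℝ) + 1) := by
      rw [eventually_all_finite (Set.finite_Iic i)]
      intro r _
      by_cases hr : p (j + 1) ≤ (en r).2.2
      · filter_upwards [Metric.tendsto_nhds.1
          (hN.tendsto_blockFilter hp (fun l => (en r).1 l) hr (en r).2.1) _ hi] with τ hτ _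
        exact hτ
      · exact Eventually.of_forall fun _ h => absurd h hr
    have h2 := Metric.tendsto_nhds.1 hlim _ hi
    have h3 : ∀ᶠ τ in blockFilter p j, blockVec p b x j τ ≠ 0 := by
      filter_upwards [hlim.eventually_ne one_ne_zero] with τ hτ
      exact norm_ne_zero_iff.1 hτ
    have h4 : ∀ᶠ τ in blockFilter p j,
        (F.Finite → F ⊆ Submodule.span ℝ (Set.range (Function.uncurry x)) →
          R F i (unitBlockVec p b x j τ)) := by
      by_cases hF : F.Finite ∧ F ⊆ Submodule.span ℝ (Set.range (Function.uncurry x))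
      · filter_upwards [hR F hF.1 hF.2 i j] with τ hτ _ _
        exact hτ
      · exact Eventually.of_forall fun _ h h' => absurd ⟨h, h'⟩ hF
    obtain ⟨τ, hτ1, hτ2, hτ3, hτ4⟩ := (h1.and (h2.and (h3.and h4))).exists
    exact ⟨τ, hτ1, hτ2, hτ3, hτ4⟩
  choose sel hs1 hs2 hs3 hs4 using hsel
  let prev : ℕ → ℕ → (ℕ → ℕ → ℕ → ℕ) → Set X := fun i j h =>
    (fun q : ℕ × ℕ => unitBlockVec p b x q.2 (h q.1 q.2)) '' (Set.Iio i ×ˢ insert j (Set.Iio i))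
  let c : ℕ → (ℕ → ℕ → ℕ → ℕ) → ℕ → ℕ → ℕ := fun i h j => sel (prev i j h) i j
  set k : ℕ → ℕ → ℕ → ℕ := historySeq c with hk
  have hkc : ∀ i j, ∃ h, (∀ i' < i, h i' = k i') ∧ k i j = sel (prev i j h) i j := by
    intro i j
    refine ⟨fun i' => if i' < i then k i' else default, fun i' hi' => if_pos hi', ?_⟩
    rw [hk, historySeq]
    rfl
  refine ⟨k, fun i j => ?_, fun j => ?_, fun a n j t hn => ?_, fun i j => ?_⟩
  · obtain ⟨h, -, hkh⟩ := hkc i j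
    rw [hkh]; exact hs3 _ _ _
  · rw [tendsto_iff_dist_tendsto_zero]
    refine squeeze_zero (fun _ => dist_nonneg) (fun i => ?_)
      (tendsto_one_div_add_atTop_nhds_zero_nat (𝕜 := ℝ))
    obtain ⟨h, -, hkh⟩ := hkc i j
    rw [hkh]; exact (hs2 _ _ _).le
  · rw [Metric.tendsto_nhds]
    intro ε hε
    obtain ⟨q, hq⟩ := exists_rational_approx a n (show 0 < ε / 4 by positivity)
    set t' : ℕ →₀ ℕ := Finsupp.onFinset (range (p j)) (fun l => if l < p j then t l else 0)
      (by simp; tauto) with ht'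
    have htt : ∀ l < p j, t' l = t l := fun l hl => by
      rw [ht', Finsupp.onFinset_apply, if_pos hl]
    obtain ⟨r, hr⟩ := hen (q, t', n)
    filter_upwards [eventually_ge_atTop r, (tendsto_one_div_add_atTop_nhds_zero_nat
      (𝕜 := ℝ)).eventually_lt_const (show 0 < ε / 2 by positivity)] with i hir hiε
    obtain ⟨h, -, hkh⟩ := hkc i j
    have h1 := hs1 (prev i j h) i j r hir (by rw [hr]; exact hn)
    rw [hr, ← hkh] at h1
    simp only at h1
    have hj := (hp (Nat.le_succ j)).trans hn
    rw [hN.congr _ hj (t := t') (t' := t) fun l hl _ => htt l hl,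
      show glue (p j) t' (k i j) = glue (p j) t (k i j) from funext fun l => by
        unfold glue; split_ifs with hl
        · exact htt l hl
        · rfl] at h1
    have h2 := (hN.abs_sub_le hx a (fun l => q l) hn (glue (p j) t (k i j))).trans hq
    have h3 := (hN.abs_sub_le hx a (fun l => q l) hj t).trans hq
    rw [Real.dist_eq, abs_lt]
    rw [abs_lt] at h1
    rw [abs_le] at h2 h3
    constructor <;> linarith [h1.1, h1.2, h2.1, h2.2, h3.1, h3.2]
  · obtain ⟨h, hh, hkh⟩ := hkc i j
    refine ⟨prev i j h, fun i' hi' j' hj' => ⟨(i', j'), ⟨hi', hj'⟩, ?_⟩, ?_⟩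
    · simp only; rw [hh i' hi']
    · rw [hkh]
      refine hs4 _ _ _ (((Set.finite_Iio i).prod ((Set.finite_Iio i).insert j)).image _) ?_
      rintro _ ⟨q, -, rfl⟩
      exact unitBlockVec_mem fun l _ => Submodule.subset_span ⟨(l, _), rfl⟩

end

/-! ### Asymptotic models -/

section

variable {x : ℕ → ℕ → X} {N : (ℕ → ℝ) → ℕ → ℕ → (ℕ → ℕ) → ℝ} {e f : ℕ → E}
  {p : ℕ → ℕ} {b : ℕ → ℝ}

theorem IsPartialLimit.generates_blocks (hN : IsPartialLimit x N)
    (hN0 : ∀ a n t, N a n 0 t = ‖∑ l ∈ range n, a l • e l‖) (hx : ∀ l, Normalized (x l))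
    (hp : Monotone p) (hp0 : p 0 = 0)
    (hfb : ∀ j, f j = ∑ l ∈ Finset.Ico (p j) (p (j + 1)), b l • e l) {k : ℕ → ℕ → ℕ → ℕ}
    (hk1 : ∀ j, Tendsto (fun i => ‖blockVec p b x j (k i j)‖) atTop (𝓝 1))
    (hk2 : ∀ a n j t, p (j + 1) ≤ n →
      Tendsto (fun i => N a n (p (j + 1)) (glue (p j) t (k i j))) atTop (𝓝 (N a n (p j) t))) :
    GeneratesAsymptoticModel (fun j i => unitBlockVec p b x j (k i j)) f := by
  intro n β
  set W : (ℕ → ℕ) → ℕ → ℕ → ℝ := fun τ s j =>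
    β j * if j < s then ‖blockVec p b x j (k (τ j) j)‖⁻¹ else 1 with hW
  set A : (ℕ → ℕ) → ℕ → ℕ → ℝ := fun τ s l => W τ s (blockIndex p l) * b l with hA
  set T : (ℕ → ℕ) → ℕ → ℕ := fun τ l => k (τ (blockIndex p l)) (blockIndex p l) l with hT
  have key : ∀ d s τ, s + d = n →
      SeqLimit s d (fun τ => ‖∑ j ∈ range n, β j • unitBlockVec p b x j (k (τ j) j)‖) τ
        (N (A τ s) (p n) (p s) (T τ)) := by
    intro d
    induction d with
    | zero =>
      intro s τ hs
      obtain rfl : s = n := by omega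
      simp only [SeqLimit]
      rw [hN.top, sum_range_block_smul hp hp0 b (W τ s) (fun j l => x l (k (τ j) j l))]
      congr 1
      refine Finset.sum_congr rfl fun j hj => ?_
      simp only [hW]
      rw [if_pos (Finset.mem_range.1 hj), mul_smul]
      rfl
    | succ d ih =>
      intro s τ hs
      refine ⟨_, fun i => ih (s + 1) _ (by omega), ?_⟩
      have hsn : p (s + 1) ≤ p n := hp (by omega)
      have hA' : ∀ l, Tendsto (fun i => A (Function.update τ s i) (s + 1) l) atTop
          (𝓝 (A τ s l)) := by
        intro l
        refine Tendsto.mul_const _ (Tendsto.const_mul _ ?_)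
        rcases lt_trichotomy (blockIndex p l) s with h | h | h
        · simp only [if_pos h, if_pos (Nat.lt_succ_of_lt h), Function.update_of_ne h.ne]
          exact tendsto_const_nhds
        · simp only [h, lt_irrefl, if_false, Nat.lt_succ_self, if_true, Function.update_self]
          simpa using (hk1 s).inv₀ one_ne_zero
        · simp only [if_neg h.not_gt, if_neg (show ¬ blockIndex p l < s + 1 by omega)]
          exact tendsto_const_nhds
      have h1 : Tendsto (fun i =>
          N (A (Function.update τ s i) (s + 1)) (p n) (p (s + 1)) (T (Function.update τ s i)) -
            N (A τ s) (p n) (p (s + 1)) (T (Function.update τ s i))) atTop (𝓝 0) := by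
        refine squeeze_zero_norm (fun i => hN.abs_sub_le hx _ _ hsn _) ?_
        have : Tendsto (fun i => ∑ l ∈ range (p n),
            |A (Function.update τ s i) (s + 1) l - A τ s l|) atTop
            (𝓝 (∑ l ∈ range (p n), |A τ s l - A τ s l|)) :=
          tendsto_finsetSum _ fun l _ => ((hA' l).sub_const _).abs
        simpa using this
      have h2 := h1.add (hk2 (A τ s) (p n) s (T τ) hsn)
      rw [zero_add] at h2
      refine h2.congr fun i => ?_
      rw [hN.congr (A τ s) hsn (t := T (Function.update τ s i))
        (t' := glue (p s) (T τ) (k i s)), sub_add_cancel]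
      intro l hl _
      unfold glue
      simp only [hT]
      split_ifs with hls
      · rw [Function.update_of_ne (blockIndex_lt hp0 hls).ne]
      · rw [blockIndex_eq hp (Finset.mem_Ico.2 ⟨not_lt.1 hls, hl⟩), Function.update_self]
  have h0 := (seqLimit_norm_iff (y := fun j i => unitBlockVec p b x j (k i j)) 0).1
    (key n 0 0 (by omega))
  rw [hp0, hN0, sum_range_block_smul hp hp0 b (W 0 0) (fun _ => e)] at h0
  convert h0 using 4 with j
  · simp [hW]
  · exact hfb _

theorem isBasicArray_of_forcesBasic {K : ℝ} {R : Set X → ℕ → X → Prop} (hR : ForcesBasic K R)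
    {y : ℕ → ℕ → X} (hy : ∀ n, Normalized (y n))
    (hyR : ∀ i j, ∃ F, (∀ i' < i, ∀ j', j' = j ∨ j' < i → y j' i' ∈ F) ∧ R F i (y j i)) :
    IsBasicArray y := by
  refine ⟨K, fun n => ⟨hy n, isCBasic_of_forall_isCBasicUpTo fun m =>
    hR m _ id strictMono_id (fun r _ => hy n r) fun r _ => ?_⟩, fun m i hi hm =>
    hR m _ i hi (fun r _ => hy r _) fun r hr => ?_⟩
  · obtain ⟨F, hF, h⟩ := hyR r n
    exact ⟨F, fun r' hr' => hF r' hr' n (Or.inl rfl), h⟩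
  · obtain ⟨F, hF, h⟩ := hyR (i r) r
    refine ⟨F, fun r' hr' => hF _ (hi hr') r' (Or.inr ?_), h⟩
    have := hi.monotone (Nat.zero_le r)
    omega

theorem eventually_mazur (hlim : ∀ j, Tendsto (fun τ => ‖blockVec p b x j τ‖)
      (blockFilter p j) (𝓝 1)) (hx : ∀ n, WeaklyNull (x n)) {F : Set X} (hF : F.Finite)
    (i j : ℕ) : ∀ᶠ τ in blockFilter p j, ∀ v ∈ Submodule.span ℝ F, ∀ a : ℝ,
      mazurConst i * ‖v‖ ≤ mazurConst (i + 1) * ‖v + a • unitBlockVec p b x j τ‖ := by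
  have hc : 0 < mazurConst i := zero_lt_one.trans_le (one_le_mazurConst i)
  obtain ⟨D, hD, δ, hδ, h⟩ := exists_finite_dual_almost_orthogonal hF
    ((one_lt_div hc).2 (mazurConst_strictMono (Nat.lt_succ_self i)))
  have hsmall : ∀ᶠ τ in blockFilter p j, ∀ g ∈ D, |g (unitBlockVec p b x j τ)| < δ := by
    rw [eventually_all_finite hD]
    intro g _
    have h1 : Tendsto (fun τ => g (blockVec p b x j τ)) (blockFilter p j) (𝓝 0) := by
      have : Tendsto (fun τ : ℕ → ℕ => ∑ l ∈ Finset.Ico (p j) (p (j + 1)), b l * g (x l (τ l)))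
          (blockFilter p j) (𝓝 (∑ l ∈ Finset.Ico (p j) (p (j + 1)), b l * 0)) :=
        tendsto_finsetSum _ fun l hl =>
          ((hx l g).comp (tendsto_eval_blockFilter hl)).const_mul _
      simpa [blockVec] using this
    have h2 := ((hlim j).inv₀ one_ne_zero).mul h1
    rw [mul_zero] at h2
    filter_upwards [Metric.tendsto_nhds.1 h2 δ hδ] with τ hτ
    simpa [unitBlockVec] using hτ
  filter_upwards [hsmall, (hlim j).eventually_ne one_ne_zero] with τ hτ hne v hv a
  have := h _ (norm_unitBlockVec (norm_ne_zero_iff.1 hne)) hτ v hv a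
  rw [div_mul_eq_mul_div, le_div_iff₀ hc] at this
  linarith

theorem eventually_block {x0 : ℕ → X} (hx : ∀ n, IsBlockBasisOf x0 (x n)) {F : Set X}
    (hF : F.Finite) (hFx : F ⊆ Submodule.span ℝ (Set.range (Function.uncurry x))) (j : ℕ) :
    ∀ᶠ τ in blockFilter p j, ∃ M, F ⊆ Submodule.span ℝ (x0 '' Set.Iio M) ∧
      unitBlockVec p b x j τ ∈ Submodule.span ℝ (x0 '' Set.Ici M) := by
  choose q c hq _ hxq using hx
  have hmem : ∀ l i M, M ≤ i → x l i ∈ Submodule.span ℝ (x0 '' Set.Ici M) := by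
    intro l i M hM
    rw [hxq]
    refine Submodule.sum_mem _ fun r hr => Submodule.smul_mem _ _ (Submodule.subset_span
      ⟨r, ?_, rfl⟩)
    exact (hM.trans ((hq l).le_apply)).trans (Finset.mem_Ico.1 hr).1
  have hF0 : ∀ v ∈ F, ∃ M, v ∈ Submodule.span ℝ (x0 '' Set.Iio M) := by
    intro v hv
    have hle : Submodule.span ℝ (Set.range (Function.uncurry x)) ≤
        Submodule.span ℝ (x0 '' Set.univ) := by
      rw [Submodule.span_le]
      rintro _ ⟨⟨l, i⟩, rfl⟩
      exact Submodule.span_mono (Set.image_mono (Set.subset_univ _)) (hmem l i 0 (Nat.zero_le _))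
    obtain ⟨d, -, L, hL⟩ := exists_eq_sum_range_of_mem_span (hle (hFx hv))
    refine ⟨L, ?_⟩
    rw [hL L le_rfl]
    exact Submodule.sum_mem _ fun r hr => Submodule.smul_mem _ _ (Submodule.subset_span
      ⟨r, Finset.mem_range.1 hr, rfl⟩)
  have hM : ∃ M, F ⊆ Submodule.span ℝ (x0 '' Set.Iio M) := by
    choose! M hM using hF0
    refine ⟨hF.toFinset.sup M, fun v hv => Submodule.span_mono (Set.image_mono
      (Set.Iio_subset_Iio (Finset.le_sup (hF.mem_toFinset.2 hv)))) (hM v hv)⟩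
  obtain ⟨M, hM⟩ := hM
  have hlarge : ∀ᶠ τ in blockFilter p j, ∀ l ∈ Finset.Ico (p j) (p (j + 1)), M ≤ τ l := by
    rw [eventually_all_finset]
    exact fun l hl => (tendsto_eval_blockFilter hl).eventually_ge_atTop M
  filter_upwards [hlarge] with τ hτ
  exact ⟨M, hM, unitBlockVec_mem fun l hl => hmem _ _ _ (hτ l hl)⟩

end

/-- Proposition 3.5: if `e` is an asymptotic model of `X` generated by a basic array which
is either weakly null or a block basic array, then every normalized block basis of `e` is
again an asymptotic model of `X`. -/
theorem stmt_5 {X : Type*} [NormedAddCommGroup X] [NormedSpace ℝ X] [CompleteSpace X]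
    {E : Type*} [NormedAddCommGroup E] [NormedSpace ℝ E]
    (e : ℕ → E) (he : Normalized e) (heb : ∃ C : ℝ, IsCBasic C e)
    (x : ℕ → ℕ → X) (harr : IsBasicArray x) (hgen : GeneratesAsymptoticModel x e)
    (hcase : (∀ n, WeaklyNull (x n)) ∨
      ∃ x0 : ℕ → X, (∃ C : ℝ, IsCBasic C x0) ∧ IsBlockBasicArray x0 x)
    (f : ℕ → E) (hf : Normalized f) (hbf : IsBlockBasisOf e f) :
    IsAsymptoticModel X f := by
  obtain ⟨p, b, hp, hp0, hfb⟩ := hbf.exists_zero_start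
  obtain ⟨C, hC⟩ := heb
  obtain ⟨K, hK⟩ := harr
  have hx : ∀ l, Normalized (x l) := fun l => (hK.1 l).1
  obtain ⟨N, hN, hN0⟩ := hgen.exists_isPartialLimit
  refine ⟨hf, ⟨C, hC.of_blocks hf hp hp0 hfb⟩, ?_⟩
  obtain ⟨K', R, hforce, hR⟩ : ∃ (K' : ℝ) (R : Set X → ℕ → X → Prop), ForcesBasic K' R ∧
      ∀ F : Set X, F.Finite → F ⊆ Submodule.span ℝ (Set.range (Function.uncurry x)) →
        ∀ i j, ∀ᶠ τ in blockFilter p j, R F i (unitBlockVec p b x j τ) := by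
    rcases hcase with hweak | ⟨x0, ⟨C0, hC0⟩, -, hrows, -⟩
    · exact ⟨2, _, forcesBasic_mazur, fun F hF _ i j => eventually_mazur
        (hN.tendsto_norm_blockVec hN0 hp.monotone hf hfb) hweak hF i j⟩
    · exact ⟨C0, _, hC0.forcesBasic, fun F hF hFx _ j => eventually_block hrows hF hFx j⟩
  obtain ⟨k, hk0, hk1, hk2, hk3⟩ := hN.exists_selection hN0 hx hp.monotone hf hfb hR
  exact ⟨fun j i => unitBlockVec p b x j (k i j),
    isBasicArray_of_forcesBasic hforce (fun j i => norm_unitBlockVec (hk0 i j)) hk3,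
    hN.generates_blocks hN0 hx hp.monotone hp0 hfb hk1 hk2⟩
end

section
/- Let X be a Banach space and let (e_i)_{i∈ω} be an asymptotic model of X generated by a basic array (x_i^n)_{n,i∈ω} in which every row (x_i^n)_{i∈ω} is weakly null. Then (e_i)_{i∈ω} is suppression-1 unconditional: for every n, every F ⊆ {0, …, n−1}, and all scalars (b_i)_{i<n}, ‖Σ_{i∈F} b_i e_i‖ ≤ ‖Σ_{i<n} b_i e_i‖. -/
open Filter Finset Topology

variable {X : Type*} [NormedAddCommGroup X] [NormedSpace ℝ X]
variable {E : Type*} [NormedAddCommGroup E] [NormedSpace ℝ E]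

theorem IteratedLimit.mono : ∀ {n : ℕ} {f g : (Fin n → ℕ) → ℝ} {L M : ℝ},
    IteratedLimit n f L → IteratedLimit n g M → (∀ t, f t ≤ g t) → L ≤ M
  | 0, _, _, _, _, hf, hg, h => hf.symm.trans_le ((h _).trans_eq hg)
  | _ + 1, _, _, _, _, ⟨_, hF, hFL⟩, ⟨_, hG, hGM⟩, h =>
    le_of_tendsto_of_tendsto' hFL hGM fun i => (hF i).mono (hG i) fun _ => h _

theorem IteratedLimit.sum_mul_add_const {ι : Type*} [Fintype ι] (w : ι → ℝ) (c : ℝ) :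
    ∀ {n : ℕ} {f : ι → (Fin n → ℕ) → ℝ} {L : ι → ℝ}, (∀ k, IteratedLimit n (f k) (L k)) →
      IteratedLimit n (fun t => ∑ k, w k * f k t + c) (∑ k, w k * L k + c)
  | 0, f, L, h => by
    have h' : ∀ k, f k (fun i => i.elim0) = L k := h
    simp only [IteratedLimit, h']
  | n + 1, f, L, h => by
    choose g hg hgL using h
    exact ⟨fun i => ∑ k, w k * g k i + c,
      fun i => IteratedLimit.sum_mul_add_const w c fun k => hg k i,
      (tendsto_finsetSum _ fun k _ => (hgL k).const_mul (w k)).add_const c⟩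

/-- Mazur's lemma for weakly null sequences: every tail has convex combinations of arbitrarily
small norm. -/
theorem WeaklyNull.exists_convex_combination_norm_lt {X : Type*} [NormedAddCommGroup X]
    [NormedSpace ℝ X] {x : ℕ → X} (hx : WeaklyNull x) (N : ℕ) {ε : ℝ} (hε : 0 < ε) :
    ∃ (ι : Type) (_ : Fintype ι) (w : ι → ℝ) (k : ι → ℕ),
      (∀ i, 0 ≤ w i) ∧ ∑ i, w i = 1 ∧ (∀ i, N ≤ k i) ∧ ‖∑ i, w i • x (k i)‖ < ε := by
  have hmem : (0 : X) ∈ closure (convexHull ℝ (x '' Set.Ici N)) := by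
    by_contra h
    obtain ⟨f, u, hu, hf⟩ := geometric_hahn_banach_point_closed
      (convex_convexHull ℝ (x '' Set.Ici N)).closure isClosed_closure h
    rw [map_zero] at hu
    have hle : u ≤ 0 := ge_of_tendsto (hx f) <| (eventually_ge_atTop N).mono fun i hi =>
      (hf _ (subset_closure (subset_convexHull ℝ _ ⟨i, hi, rfl⟩))).le
    exact absurd hu hle.not_gt
  obtain ⟨v, hv, hvε⟩ := Metric.mem_closure_iff.mp hmem ε hε
  rw [dist_zero_left] at hvε
  obtain ⟨ι, _, w, z, hw, hw1, hz, rfl⟩ := mem_convexHull_iff_exists_fintype.mp hv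
  choose k hk hkz using hz
  exact ⟨ι, inferInstance, w, k, hw, hw1, hk, by simpa only [hkz] using hvε⟩

/-- Deleting the `j`-th summand, taken from a weakly null row, does not increase the iterated
limit of the norms. -/
theorem IteratedLimit.le_of_delete {X : Type*} [NormedAddCommGroup X] [NormedSpace ℝ X] :
    ∀ {n : ℕ} {y : Fin n → ℕ → X} (_ : ∀ j, WeaklyNull (y j)) (u : X) {b c : Fin n → ℝ}
      {j : Fin n} (_ : c j = 0) (_ : ∀ i, i ≠ j → c i = b i) {L M : ℝ},
      IteratedLimit n (fun t => ‖u + ∑ i, c i • y i (t i)‖) L →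
      IteratedLimit n (fun t => ‖u + ∑ i, b i • y i (t i)‖) M → L ≤ M
  | 0, _, _, _, _, _, j, _, _, _, _, _, _ => j.elim0
  | n + 1, y, hy, u, b, c, j, hj, hcb, L, M, ⟨g, hg, hgL⟩, ⟨h, hh, hhM⟩ => by
    simp only [Fin.sum_univ_succ, Fin.cons_zero, Fin.cons_succ] at hg hh
    cases j using Fin.cases with
    | zero =>
      have hcb' : ∀ i : Fin n, c i.succ = b i.succ := fun i => hcb _ (Fin.succ_ne_zero i)
      simp only [hj, hcb', zero_smul, zero_add] at hg
      refine le_of_tendsto' hgL fun m => le_of_forall_pos_le_add fun ε hε => ?_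
      obtain ⟨N, hN⟩ := eventually_atTop.mp (hhM.eventually_le_const
        (lt_add_of_pos_right M (half_pos hε)))
      have hB : 0 < |b 0| + 1 := by positivity
      obtain ⟨ι, _, w, k, hw, hw1, hk, hsmall⟩ :=
        (hy 0).exists_convex_combination_norm_lt N (div_pos (half_pos hε) hB)
      have hsmall' : ‖b 0 • ∑ i, w i • y 0 (k i)‖ ≤ ε / 2 := by
        rw [lt_div_iff₀ hB] at hsmall
        rw [norm_smul, Real.norm_eq_abs]
        nlinarith [norm_nonneg (∑ i, w i • y 0 (k i))]
      have hle : g m ≤ ∑ i, w i * h (k i) + ε / 2 := by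
        refine (hg m).mono (IteratedLimit.sum_mul_add_const w (ε / 2) fun i => hh (k i))
          fun t => ?_
        set v := ∑ i : Fin n, b i.succ • y i.succ (t i)
        have hcomb : u + v = ∑ i, w i • (u + (b 0 • y 0 (k i) + v))
            - b 0 • ∑ i, w i • y 0 (k i) := by
          simp only [smul_add, Finset.sum_add_distrib, ← Finset.sum_smul, hw1, one_smul,
            Finset.smul_sum, smul_comm (b 0)]
          abel
        rw [hcomb]
        refine (norm_sub_le _ _).trans (add_le_add ((norm_sum_le _ _).trans_eq ?_) hsmall')
        exact Finset.sum_congr rfl fun i _ => by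
          rw [norm_smul, Real.norm_of_nonneg (hw i)]
      have havg : ∑ i, w i * h (k i) ≤ M + ε / 2 := by
        calc ∑ i, w i * h (k i) ≤ ∑ i, w i * (M + ε / 2) :=
              Finset.sum_le_sum fun i _ => mul_le_mul_of_nonneg_left (hN _ (hk i)) (hw i)
          _ = M + ε / 2 := by rw [← Finset.sum_mul, hw1, one_mul]
      linarith
    | succ j =>
      rw [hcb 0 (Fin.succ_ne_zero j).symm] at hg
      simp only [← add_assoc] at hg hh
      exact le_of_tendsto_of_tendsto' hgL hhM fun m =>
        IteratedLimit.le_of_delete (fun i => hy i.succ) _ hj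
          (fun i hi => hcb _ ((Fin.succ_injective n).ne hi)) (hg m) (hh m)

/-- Remark 3.6 (3.8): an asymptotic model generated by a basic array all of whose rows
are weakly null is suppression-1 unconditional. -/
theorem stmt_7 {X : Type*} [NormedAddCommGroup X] [NormedSpace ℝ X] [CompleteSpace X]
    {E : Type*} [NormedAddCommGroup E] [NormedSpace ℝ E]
    (e : ℕ → E) (he : Normalized e) (heb : ∃ C : ℝ, IsCBasic C e)
    (x : ℕ → ℕ → X) (harr : IsBasicArray x) (hweak : ∀ n, WeaklyNull (x n))
    (hgen : GeneratesAsymptoticModel x e) :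
    ∀ (n : ℕ) (F : Finset ℕ), F ⊆ Finset.range n → ∀ b : ℕ → ℝ,
      ‖∑ i ∈ F, b i • e i‖ ≤ ‖∑ i ∈ Finset.range n, b i • e i‖ := by
  intro n F hF b
  have key : ∀ G : Finset ℕ, G ⊆ Finset.range n →
      ‖∑ i ∈ Finset.range n \ G, b i • e i‖ ≤ ‖∑ i ∈ Finset.range n, b i • e i‖ := by
    intro G
    induction G using Finset.induction_on with
    | empty => simp
    | insert j G hjG ih =>
      intro hsub
      obtain ⟨hj, hG⟩ := Finset.insert_subset_iff.mp hsub
      refine le_trans ?_ (ih hG)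
      have hsum : ∀ H : Finset ℕ, ∑ i ∈ Finset.range n \ H, b i • e i
          = ∑ i ∈ Finset.range n, (if i ∈ H then 0 else b i) • e i := by
        intro H
        rw [Finset.sdiff_eq_filter, Finset.sum_filter]
        exact Finset.sum_congr rfl fun i _ => by split_ifs <;> simp_all
      rw [hsum, hsum]
      refine IteratedLimit.le_of_delete (y := fun i : Fin n => x i) (fun i => hweak i) 0
        (c := fun i : Fin n => if (i : ℕ) ∈ insert j G then 0 else b i)
        (b := fun i : Fin n => if (i : ℕ) ∈ G then 0 else b i)
        (j := ⟨j, Finset.mem_range.mp hj⟩) (by simp) ?_ ?_ ?_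
      · intro i hi
        have hij : (i : ℕ) ≠ j := fun h => hi (Fin.ext h)
        simp [hij]
      · simpa only [zero_add] using hgen n fun i => if i ∈ insert j G then 0 else b i
      · simpa only [zero_add] using hgen n fun i => if i ∈ G then 0 else b i
  simpa only [Finset.sdiff_sdiff_eq_self hF] using key (Finset.range n \ F) Finset.sdiff_subset
end
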